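/- The rotation number induces a bijection between horizontal isotopy classes of horizontal loops in the standard Engel space (ℝ⁴, 𝒟) and the integers: (i) two horizontal loops are horizontally isotopic if and only if their rotation numbers agree, and (ii) every integer is the rotation number of some horizontal loop. -/

import Mathlib

/-- A horizontal loop in the standard Engel space `(ℝ⁴, 𝒟)`, where
`𝒟 = ker(dz - y dx) ∩ ker(dw - z dx)`: a smooth 1-periodic curve
`γ = (x,y,z,w)` with nowhere-vanishing derivative, injective modulo the
period, tangent to `𝒟`, i.e. `z' = y·x'` and `w' = z·x'`. -/
structure IsHorizontalLoop (γ : ℝ → ℝ × ℝ × ℝ × ℝ) : Prop where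
  smooth : ContDiff ℝ (⊤ : ℕ∞) γ
  periodic : Function.Periodic γ 1
  immersed : ∀ s : ℝ, deriv γ s ≠ 0
  tangent_z : ∀ s : ℝ, deriv (fun t => (γ t).2.2.1) s
      = (γ s).2.1 * deriv (fun t => (γ t).1) s
  tangent_w : ∀ s : ℝ, deriv (fun t => (γ t).2.2.2) s
      = (γ s).2.2.1 * deriv (fun t => (γ t).1) s
  injOnPeriod : ∀ s₀ s₁ : ℝ, γ s₀ = γ s₁ → ∃ k : ℤ, s₁ - s₀ = (k : ℝ)

/-- `rot(γ) = n`: the winding number of `s ↦ (x'(s), y'(s))` around the origin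
over one period equals `n`, expressed via a continuous angle function `θ`. -/
def HasRotationNumber (γ : ℝ → ℝ × ℝ × ℝ × ℝ) (n : ℤ) : Prop :=
  ∃ θ : ℝ → ℝ, Continuous θ ∧
    (∀ s : ℝ,
      deriv (fun t => (γ t).1) s
        = Real.sqrt ((deriv (fun t => (γ t).1) s) ^ 2
            + (deriv (fun t => (γ t).2.1) s) ^ 2) * Real.cos (θ s) ∧
      deriv (fun t => (γ t).2.1) s
        = Real.sqrt ((deriv (fun t => (γ t).1) s) ^ 2
            + (deriv (fun t => (γ t).2.1) s) ^ 2) * Real.sin (θ s)) ∧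
    θ 1 - θ 0 = 2 * Real.pi * (n : ℝ)

/-- A horizontal isotopy: a smooth map `H : [0,1] × ℝ → ℝ⁴` such that each
`H t` (for `t ∈ [0,1]`) is a horizontal loop. -/
def IsHorizontalIsotopy (H : ℝ → ℝ → ℝ × ℝ × ℝ × ℝ) : Prop :=
  ContDiffOn ℝ (⊤ : ℕ∞) (Function.uncurry H) (Set.Icc (0:ℝ) 1 ×ˢ (Set.univ : Set ℝ)) ∧
  ∀ t ∈ Set.Icc (0:ℝ) 1, IsHorizontalLoop (H t)

open Set Filter Topology MeasureTheory intervalIntegral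
open scoped ContDiff

section Analysis

/-- Differentiation under the integral sign for integrands that are jointly `C¹`. -/
theorem hasFDerivAt_intervalIntegral_of_contDiff {E F : Type*}
    [NormedAddCommGroup E] [NormedSpace ℝ E] [ProperSpace E]
    [NormedAddCommGroup F] [NormedSpace ℝ F]
    {h : E → ℝ → F} (hh : ContDiff ℝ 1 (Function.uncurry h)) (p₀ : E) :
    HasFDerivAt (fun p => ∫ σ in (0 : ℝ)..1, h p σ)
      (∫ σ in (0 : ℝ)..1,
        (fderiv ℝ (Function.uncurry h) (p₀, σ)).comp (ContinuousLinearMap.inl ℝ E ℝ)) p₀ := by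
  have hcD : Continuous fun q : E × ℝ =>
      (fderiv ℝ (Function.uncurry h) q).comp (ContinuousLinearMap.inl ℝ E ℝ) :=
    (hh.continuous_fderiv (by simp)).clm_comp continuous_const
  obtain ⟨C, hC⟩ := ((isCompact_closedBall p₀ (1 : ℝ)).prod
    (isCompact_Icc (a := (0 : ℝ)) (b := 1))).exists_bound_of_continuousOn hcD.continuousOn
  have hc : Continuous (Function.uncurry h) := hh.continuous
  refine hasFDerivAt_integral_of_dominated_of_fderiv_le (bound := fun _ => C)
    (Metric.ball_mem_nhds p₀ one_pos) ?_ ?_ ?_ ?_ ?_ ?_ (𝕜 := ℝ)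
    (F' := fun p σ => (fderiv ℝ (Function.uncurry h) (p, σ)).comp
      (ContinuousLinearMap.inl ℝ E ℝ))
  · exact Eventually.of_forall fun p =>
      (hc.comp (Continuous.prodMk_right p)).aestronglyMeasurable
  · exact (hc.comp (Continuous.prodMk_right p₀)).intervalIntegrable _ _
  · exact (hcD.comp (Continuous.prodMk_right p₀)).aestronglyMeasurable
  · refine Eventually.of_forall fun σ hσ p hp => hC (p, σ) ⟨Metric.ball_subset_closedBall hp, ?_⟩
    rw [uIoc_of_le zero_le_one] at hσ
    exact ⟨hσ.1.le, hσ.2⟩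
  · exact intervalIntegrable_const
  · refine Eventually.of_forall fun σ _ p _ => ?_
    have h1 : HasFDerivAt (Function.uncurry h) (fderiv ℝ (Function.uncurry h) (p, σ)) (p, σ) :=
      (hh.differentiable (by simp) (p, σ)).hasFDerivAt
    exact HasFDerivAt.comp (f := fun e : E => (e, σ)) p h1 (hasFDerivAt_prodMk_left p σ)

theorem contDiff_nat_intervalIntegral {E : Type} [NormedAddCommGroup E] [NormedSpace ℝ E]
    [ProperSpace E] (n : ℕ) :
    ∀ {F : Type} [NormedAddCommGroup F] [NormedSpace ℝ F] {h : E → ℝ → F},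
      ContDiff ℝ n (Function.uncurry h) →
      ContDiff ℝ n (fun p => ∫ σ in (0 : ℝ)..1, h p σ) := by
  induction n with
  | zero =>
    intro F _ _ h hh
    simp only [Nat.cast_zero, contDiff_zero] at hh ⊢
    exact continuous_parametric_intervalIntegral_of_continuous' hh 0 1
  | succ n ih =>
    intro F _ _ h hh
    have hh1 : ContDiff ℝ 1 (Function.uncurry h) := hh.of_le (by simp)
    have hd := hasFDerivAt_intervalIntegral_of_contDiff hh1
    push_cast at hh ⊢
    rw [contDiff_succ_iff_fderiv] at hh ⊢
    refine ⟨fun p => (hd p).differentiableAt, by simp, ?_⟩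
    rw [show fderiv ℝ (fun p => ∫ σ in (0 : ℝ)..1, h p σ) = _ from
      funext fun p => (hd p).fderiv]
    exact ih (h := fun p σ => (fderiv ℝ (Function.uncurry h) (p, σ)).comp
      (ContinuousLinearMap.inl ℝ E ℝ)) (hh.2.2.clm_comp contDiff_const)

/-- Integrals of smooth families over `[0, 1]` depend smoothly on the parameter. -/
theorem contDiff_intervalIntegral {E : Type} [NormedAddCommGroup E] [NormedSpace ℝ E]
    [ProperSpace E] {h : E → ℝ → ℝ} (hh : ContDiff ℝ ∞ (Function.uncurry h)) :
    ContDiff ℝ ∞ (fun p => ∫ σ in (0 : ℝ)..1, h p σ) :=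
  contDiff_infty.2 fun n => contDiff_nat_intervalIntegral n (contDiff_infty.1 hh n)

/-- Primitives of smooth families depend smoothly on the parameter and the endpoint. -/
theorem contDiff_primitive {h : ℝ → ℝ → ℝ} (hh : ContDiff ℝ ∞ (Function.uncurry h)) :
    ContDiff ℝ ∞ (fun p : ℝ × ℝ => ∫ σ in (0 : ℝ)..p.2, h p.1 σ) := by
  have key : (fun p : ℝ × ℝ => ∫ σ in (0 : ℝ)..p.2, h p.1 σ) =
      fun p : ℝ × ℝ => p.2 * ∫ σ in (0 : ℝ)..1, h p.1 (p.2 * σ) := by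
    funext p
    simp
  rw [key]
  refine contDiff_snd.mul (contDiff_intervalIntegral (h := fun (p : ℝ × ℝ) σ => h p.1 (p.2 * σ)) ?_)
  exact hh.comp (g := Function.uncurry h) (f := fun q : (ℝ × ℝ) × ℝ => (q.1.1, q.1.2 * q.2))
    (by fun_prop)

/-- Cramer's rule preserves any regularity of matrix entries closed under ring operations. -/
theorem contDiff_inv_mulVec {E : Type*} [NormedAddCommGroup E] [NormedSpace ℝ E]
    {n : WithTop ℕ∞} {A : E → Matrix (Fin 3) (Fin 3) ℝ} {b : E → Fin 3 → ℝ} {p : E}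
    (hA : ∀ i j, ContDiffAt ℝ n (fun q => A q i j) p)
    (hb : ∀ i, ContDiffAt ℝ n (fun q => b q i) p)
    (hdet : (A p).det ≠ 0) (i : Fin 3) :
    ContDiffAt ℝ n (fun q => ((A q)⁻¹.mulVec (b q)) i) p := by
  have hdetc : ContDiffAt ℝ n (fun q => (A q).det) p := by
    simp only [Matrix.det_fin_three]
    fun_prop (disch := simp)
  have hadj : ∀ j k, ContDiffAt ℝ n (fun q => (A q).adjugate j k) p := by
    intro j k
    simp only [Matrix.adjugate_fin_three]
    fin_cases j <;> fin_cases k <;> simp <;> fun_prop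
  simp only [Matrix.inv_def, Ring.inverse_eq_inv', Matrix.smul_apply,
    Matrix.mulVec, dotProduct, smul_eq_mul, Fin.sum_univ_three]
  have := hdetc.inv hdet
  have := hadj i
  fun_prop

end Analysis

section Moments

/-- The moments `∫ₐᵇ k xⁱ` for `i = 0, 1, 2`. -/
noncomputable def moment (k x : ℝ → ℝ) (a b : ℝ) (i : Fin 3) : ℝ :=
  ∫ s in a..b, k s * x s ^ (i : ℕ)

/-- The Gram matrix of `1, x, x²` on `[a, b]` with respect to the weight `χ`. -/
noncomputable def gramMatrix (χ x : ℝ → ℝ) (a b : ℝ) : Matrix (Fin 3) (Fin 3) ℝ :=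
  Matrix.of fun i j => ∫ s in a..b, χ s * x s ^ (i : ℕ) * x s ^ (j : ℕ)

theorem moment_weighted_polynomial {χ x : ℝ → ℝ} (hχ : Continuous χ) (hx : Continuous x)
    (a b : ℝ) (c : Fin 3 → ℝ) (i : Fin 3) :
    moment (fun s => χ s * ∑ j : Fin 3, c j * x s ^ (j : ℕ)) x a b i =
      (gramMatrix χ x a b).mulVec c i := by
  simp only [moment, Matrix.mulVec, dotProduct, gramMatrix, Matrix.of_apply]
  simp_rw [← intervalIntegral.integral_mul_const]
  rw [← intervalIntegral.integral_finsetSum]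
  · congr 1; funext s
    rw [Finset.mul_sum, Finset.sum_mul]
    exact Finset.sum_congr rfl fun j _ => by ring
  · intro j _
    exact Continuous.intervalIntegrable (by fun_prop) _ _

/-- A polynomial of degree at most two that vanishes on the germ of a curve with nonzero
derivative is zero. -/
theorem coeff_eq_zero_of_eventually {x f : ℝ → ℝ} (hx : ∀ s, HasDerivAt x (f s) s)
    (hf : Continuous f) {s₀ : ℝ} (hs₀ : f s₀ ≠ 0) {c : Fin 3 → ℝ}
    (h : ∀ᶠ s in 𝓝 s₀, ∑ j : Fin 3, c j * x s ^ (j : ℕ) = 0) : c = 0 := by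
  have hfe : ∀ᶠ s in 𝓝 s₀, f s ≠ 0 := hf.continuousAt.eventually_ne hs₀
  have step : ∀ {u v : ℝ → ℝ}, (∀ s, HasDerivAt u (v s * f s) s) → (∀ᶠ s in 𝓝 s₀, u s = 0) →
      ∀ᶠ s in 𝓝 s₀, v s = 0 := by
    intro u v huv hu
    filter_upwards [hu.eventually_nhds, hfe] with s hs hfs
    have h1 : deriv u s = 0 := by
      rw [Filter.EventuallyEq.deriv_eq (f := fun _ => (0 : ℝ)) hs]; simp
    rw [(huv s).deriv] at h1
    exact (mul_eq_zero.1 h1).resolve_right hfs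
  simp only [Fin.sum_univ_three, Fin.val_zero, Fin.val_one, Fin.val_two, pow_zero, pow_one,
    mul_one] at h
  have h1 := step (u := fun s => c 0 + c 1 * x s + c 2 * x s ^ 2)
    (v := fun s => c 1 + c 2 * (2 * x s)) (fun s => by
      refine ((((hx s).const_mul (c 1)).const_add (c 0)).add
        (((hx s).pow 2).const_mul (c 2))).congr_deriv ?_
      push_cast; ring) h
  have h2 := step (u := fun s => c 1 + c 2 * (2 * x s)) (v := fun _ => c 2 * 2) (fun s => by
      refine ((((hx s).const_mul 2).const_mul (c 2)).const_add (c 1)).congr_deriv ?_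
      ring) h1
  have c2 : c 2 = 0 := by simpa using h2.self_of_nhds
  have c1 : c 1 = 0 := by simpa [c2] using h1.self_of_nhds
  have c0 : c 0 = 0 := by simpa [c2, c1] using h.self_of_nhds
  funext i
  fin_cases i <;> simp [c0, c1, c2]

theorem det_gramMatrix_ne_zero {x f χ : ℝ → ℝ} (hx : ∀ s, HasDerivAt x (f s) s)
    (hf : Continuous f) (hχ : Continuous χ) {a b : ℝ} (hχ0 : ∀ s ∈ Icc a b, 0 ≤ χ s)
    (hχf : ∀ s ∈ Ioo a b, f s ≠ 0 → χ s ≠ 0) (hne : ∃ s ∈ Ioo a b, f s ≠ 0) :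
    (gramMatrix χ x a b).det ≠ 0 := by
  intro hdet
  obtain ⟨s₀, hs₀, hfs₀⟩ := hne
  obtain ⟨c, hc, hMc⟩ := Matrix.exists_mulVec_eq_zero_iff.2 hdet
  apply hc
  have hxc : Continuous x := continuous_iff_continuousAt.2 fun s => (hx s).continuousAt
  set P : ℝ → ℝ := fun s => ∑ j : Fin 3, c j * x s ^ (j : ℕ) with hP
  have hPc : Continuous P := by fun_prop
  have hint : ∫ s in a..b, χ s * P s ^ 2 = 0 := by
    have h1 : ∑ i : Fin 3, c i * moment (fun s => χ s * P s) x a b i = 0 := by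
      refine Finset.sum_eq_zero fun i _ => ?_
      rw [moment_weighted_polynomial hχ hxc, hMc]; simp
    rw [← h1]
    simp only [moment, ← intervalIntegral.integral_const_mul]
    rw [← intervalIntegral.integral_finsetSum]
    · congr 1; funext s
      rw [pow_two]
      conv_lhs => rw [← mul_assoc]; rhs; rw [hP]
      rw [Finset.mul_sum]
      exact Finset.sum_congr rfl fun j _ => by ring
    · intro j _
      exact Continuous.intervalIntegrable (by fun_prop) _ _
  have hzero : ∀ s ∈ Icc a b, χ s * P s ^ 2 = 0 := by
    intro s hs
    by_contra hne
    have hpos : 0 < χ s * P s ^ 2 :=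
      lt_of_le_of_ne (mul_nonneg (hχ0 s hs) (sq_nonneg _)) (Ne.symm hne)
    have := intervalIntegral.integral_pos (hs₀.1.trans hs₀.2)
      (f := fun s => χ s * P s ^ 2) (by fun_prop)
      (fun s hs => mul_nonneg (hχ0 s ⟨hs.1.le, hs.2⟩) (sq_nonneg _)) ⟨s, hs, hpos⟩
    exact this.ne' hint
  refine coeff_eq_zero_of_eventually hx hf hfs₀ ?_
  filter_upwards [hf.continuousAt.eventually_ne hfs₀, Ioo_mem_nhds hs₀.1 hs₀.2] with s h1 h2
  have := hzero s ⟨h2.1.le, h2.2.le⟩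
  simpa [hχf s h2 h1] using this

/-- Any prescribed triple of moments is realised by `χ` times a polynomial in `x`. -/
theorem exists_polynomial_moment_eq {x f χ : ℝ → ℝ} (hx : ∀ s, HasDerivAt x (f s) s)
    (hf : Continuous f) (hχ : Continuous χ) {a b : ℝ} (hχ0 : ∀ s ∈ Icc a b, 0 ≤ χ s)
    (hχf : ∀ s ∈ Ioo a b, f s ≠ 0 → χ s ≠ 0) (hne : ∃ s ∈ Ioo a b, f s ≠ 0) (m : Fin 3 → ℝ) :
    ∃ c : Fin 3 → ℝ, ∀ i,
      moment (fun s => χ s * ∑ j : Fin 3, c j * x s ^ (j : ℕ)) x a b i = m i := by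
  have hxc : Continuous x := continuous_iff_continuousAt.2 fun s => (hx s).continuousAt
  have hdet := det_gramMatrix_ne_zero hx hf hχ hχ0 hχf hne
  refine ⟨(gramMatrix χ x a b)⁻¹.mulVec m, fun i => ?_⟩
  rw [moment_weighted_polynomial hχ hxc, Matrix.mulVec_mulVec,
    Matrix.mul_nonsing_inv _ hdet.isUnit, Matrix.one_mulVec]

end Moments

section Families

/-- A smooth family of nonconstant periodic functions `x t` with derivatives `f t`. -/
structure IsBaseFamily (x f : ℝ → ℝ → ℝ) : Prop where
  contDiff_x : ContDiff ℝ ∞ (Function.uncurry x)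
  contDiff_f : ContDiff ℝ ∞ (Function.uncurry f)
  hasDerivAt : ∀ t s, HasDerivAt (x t) (f t s) s
  periodic : ∀ t, Function.Periodic (x t) 1
  exists_ne_zero : ∀ t, ∃ s, f t s ≠ 0

/-- A smooth family of periodic functions `g t` whose moments against `1, x t, (x t)²` over a
period vanish; these are the derivatives of the `y`-coordinates of closed horizontal curves with
`x`-coordinate `x t`. -/
structure IsAdmissible (x g : ℝ → ℝ → ℝ) : Prop where
  contDiff : ContDiff ℝ ∞ (Function.uncurry g)
  periodic : ∀ t, Function.Periodic (g t) 1
  moment_eq_zero : ∀ t i, moment (g t) (x t) 0 1 i = 0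

variable {x f : ℝ → ℝ → ℝ}

theorem ContDiff.of_uncurry_apply {g : ℝ → ℝ → ℝ} (hg : ContDiff ℝ ∞ (Function.uncurry g))
    (t : ℝ) : ContDiff ℝ ∞ (g t) :=
  hg.comp (g := Function.uncurry g) (f := fun s : ℝ => (t, s)) (by fun_prop)

theorem IsBaseFamily.periodic_f (h : IsBaseFamily x f) (t : ℝ) : Function.Periodic (f t) 1 := by
  intro s
  have h1 : HasDerivAt (fun s => x t (s + 1)) (f t (s + 1)) s :=
    (h.hasDerivAt t (s + 1)).comp_add_const s 1
  rw [show (fun s => x t (s + 1)) = x t from funext (h.periodic t)] at h1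
  exact h1.unique (h.hasDerivAt t s)

/-- Any nonzero value of `f t` is attained in the interior of a period. -/
theorem IsBaseFamily.exists_ne_zero_Ioo (h : IsBaseFamily x f) (t a : ℝ) :
    ∃ s ∈ Ioo a (a + 1), f t s ≠ 0 := by
  by_contra! hc
  obtain ⟨s, hs⟩ := h.exists_ne_zero t
  have hcl : ∀ r ∈ Icc a (a + 1), f t r = 0 := by
    have hclosed : IsClosed {r | f t r = 0} :=
      isClosed_eq (h.contDiff_f.of_uncurry_apply t).continuous continuous_const
    have : closure (Ioo a (a + 1)) ⊆ {r | f t r = 0} := closure_minimal hc hclosed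
    rwa [closure_Ioo (by linarith)] at this
  obtain ⟨r, hr, hrs⟩ := (h.periodic_f t).exists_mem_Ico one_pos s a
  exact hs (hrs ▸ hcl r ⟨hr.1, hr.2.le⟩)

theorem IsBaseFamily.det_gramMatrix_ne_zero (h : IsBaseFamily x f) (t : ℝ) :
    (gramMatrix (fun s => f t s ^ 2) (x t) 0 1).det ≠ 0 := by
  have hf := (h.contDiff_f.of_uncurry_apply t).continuous
  refine _root_.det_gramMatrix_ne_zero (h.hasDerivAt t) hf (by fun_prop)
    (fun _ _ => sq_nonneg _) (fun _ _ hs => pow_ne_zero 2 hs) ?_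
  simpa using h.exists_ne_zero_Ioo t 0

/-- The coefficients of the projection of `k t` to the span of `1, x t, (x t)²`. -/
noncomputable def correctionCoeff (x f k : ℝ → ℝ → ℝ) (t : ℝ) : Fin 3 → ℝ :=
  (gramMatrix (fun s => f t s ^ 2) (x t) 0 1)⁻¹.mulVec (moment (k t) (x t) 0 1)

/-- The correction of `k` by `f²` times a polynomial in `x` that makes its moments vanish. -/
noncomputable def corrected (x f k : ℝ → ℝ → ℝ) (t s : ℝ) : ℝ :=
  k t s - f t s ^ 2 * ∑ j : Fin 3, correctionCoeff x f k t j * x t s ^ (j : ℕ)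

theorem corrected_of_f_eq_zero {k : ℝ → ℝ → ℝ} {t s : ℝ} (hs : f t s = 0) :
    corrected x f k t s = k t s := by simp [corrected, hs]

theorem corrected_of_moment_eq_zero {k : ℝ → ℝ → ℝ} {t : ℝ}
    (hk : ∀ i, moment (k t) (x t) 0 1 i = 0) : corrected x f k t = k t := by
  funext s
  have : correctionCoeff x f k t = 0 := by
    rw [correctionCoeff, show moment (k t) (x t) 0 1 = 0 from funext hk, Matrix.mulVec_zero]
  simp [corrected, this]

theorem moment_sub {k l y : ℝ → ℝ} (hk : Continuous k) (hl : Continuous l) (hy : Continuous y)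
    (a b : ℝ) (i : Fin 3) :
    moment (fun s => k s - l s) y a b i = moment k y a b i - moment l y a b i := by
  simp only [moment, sub_mul]
  exact intervalIntegral.integral_sub (Continuous.intervalIntegrable (by fun_prop) _ _)
    (Continuous.intervalIntegrable (by fun_prop) _ _)

theorem contDiff_moment {k : ℝ → ℝ → ℝ} (hx : ContDiff ℝ ∞ (Function.uncurry x))
    (hk : ContDiff ℝ ∞ (Function.uncurry k)) (i : Fin 3) :
    ContDiff ℝ ∞ (fun t => moment (k t) (x t) 0 1 i) :=
  contDiff_intervalIntegral (h := fun t s => k t s * x t s ^ (i : ℕ)) (hk.mul (hx.pow _))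

theorem IsBaseFamily.contDiff_correctionCoeff (h : IsBaseFamily x f) {k : ℝ → ℝ → ℝ}
    (hk : ContDiff ℝ ∞ (Function.uncurry k)) (i : Fin 3) :
    ContDiff ℝ ∞ (fun t => correctionCoeff x f k t i) := by
  refine contDiff_iff_contDiffAt.2 fun t => contDiff_inv_mulVec
    (A := fun t => gramMatrix (fun s => f t s ^ 2) (x t) 0 1)
    (b := fun t => moment (k t) (x t) 0 1) (fun i j => ?_) (fun i => ?_)
    (h.det_gramMatrix_ne_zero t) i
  · exact (contDiff_intervalIntegral
      (h := fun t s => f t s ^ 2 * x t s ^ (i : ℕ) * x t s ^ (j : ℕ))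
      (((h.contDiff_f.pow 2).mul (h.contDiff_x.pow _)).mul (h.contDiff_x.pow _))).contDiffAt
  · exact (contDiff_moment h.contDiff_x hk i).contDiffAt

theorem IsBaseFamily.isAdmissible_corrected (h : IsBaseFamily x f) {k : ℝ → ℝ → ℝ}
    (hk : ContDiff ℝ ∞ (Function.uncurry k)) (hkp : ∀ t, Function.Periodic (k t) 1) :
    IsAdmissible x (corrected x f k) where
  contDiff := by
    have hc := h.contDiff_correctionCoeff hk
    have hsum : ContDiff ℝ ∞ fun p : ℝ × ℝ =>
        ∑ j : Fin 3, correctionCoeff x f k p.1 j * x p.1 p.2 ^ (j : ℕ) :=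
      ContDiff.sum fun j _ => ((hc j).comp contDiff_fst).mul (h.contDiff_x.pow _)
    exact hk.sub ((h.contDiff_f.pow 2).mul hsum)
  periodic t s := by
    simp only [corrected, hkp t s, h.periodic_f t s, h.periodic t s]
  moment_eq_zero t i := by
    have hkc := (hk.of_uncurry_apply t).continuous
    have hfc := (h.contDiff_f.of_uncurry_apply t).continuous
    have hxc := (h.contDiff_x.of_uncurry_apply t).continuous
    change moment (fun s => k t s - f t s ^ 2 *
      ∑ j : Fin 3, correctionCoeff x f k t j * x t s ^ (j : ℕ)) (x t) 0 1 i = 0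
    rw [moment_sub (l := fun s => f t s ^ 2 *
      ∑ j : Fin 3, correctionCoeff x f k t j * x t s ^ (j : ℕ)) hkc (by fun_prop) hxc,
      moment_weighted_polynomial (χ := fun s => f t s ^ 2) (by fun_prop) hxc,
      correctionCoeff, Matrix.mulVec_mulVec,
      Matrix.mul_nonsing_inv _ (h.det_gramMatrix_ne_zero t).isUnit, Matrix.one_mulVec, sub_self]

end Families

section DoublePoints

variable {x f g : ℝ → ℝ → ℝ}

/-- The closed horizontal curve with `x`-coordinate `x t` and `y' = g t` passes through the same
point at the times `a` and `b`. -/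
def SelfMeets (x g : ℝ → ℝ → ℝ) (t a b : ℝ) : Prop :=
  x t a = x t b ∧ ∀ i, moment (g t) (x t) a b i = 0

theorem moment_eq_sub {k y : ℝ → ℝ} (hk : Continuous k) (hy : Continuous y) (a b : ℝ)
    (i : Fin 3) : moment k y a b i = moment k y 0 b i - moment k y 0 a i := by
  have hc : Continuous fun s => k s * y s ^ (i : ℕ) := by fun_prop
  rw [moment, moment, moment, intervalIntegral.integral_interval_sub_left
    (hc.intervalIntegrable _ _) (hc.intervalIntegrable _ _)]

theorem moment_add {k l y : ℝ → ℝ} (hk : Continuous k) (hl : Continuous l) (hy : Continuous y)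
    (a b : ℝ) (i : Fin 3) :
    moment (fun s => k s + l s) y a b i = moment k y a b i + moment l y a b i := by
  simp only [moment, add_mul]
  exact intervalIntegral.integral_add (Continuous.intervalIntegrable (by fun_prop) _ _)
    (Continuous.intervalIntegrable (by fun_prop) _ _)

theorem moment_const_mul (c : ℝ) (k y : ℝ → ℝ) (a b : ℝ) (i : Fin 3) :
    moment (fun s => c * k s) y a b i = c * moment k y a b i := by
  simp only [moment, mul_assoc, intervalIntegral.integral_const_mul]

theorem moment_sum {ι : Type*} (S : Finset ι) {k : ι → ℝ → ℝ} {y : ℝ → ℝ}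
    (hk : ∀ j, Continuous (k j)) (hy : Continuous y) (a b : ℝ) (i : Fin 3) :
    moment (fun s => ∑ j ∈ S, k j s) y a b i = ∑ j ∈ S, moment (k j) y a b i := by
  simp only [moment, Finset.sum_mul]
  exact intervalIntegral.integral_finsetSum fun j _ =>
    Continuous.intervalIntegrable (by have := hk j; fun_prop) _ _

theorem moment_congr {k l y : ℝ → ℝ} {a b : ℝ} (hab : a ≤ b)
    (h : ∀ s ∈ Icc a b, k s = l s) (i : Fin 3) : moment k y a b i = moment l y a b i := by
  refine intervalIntegral.integral_congr fun s hs => ?_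
  rw [uIcc_of_le hab] at hs
  simp only [h s hs]

theorem moment_add_one {k y : ℝ → ℝ} (hk : Continuous k) (hy : Continuous y)
    (hkp : Function.Periodic k 1) (hyp : Function.Periodic y 1) (s : ℝ) (i : Fin 3) :
    moment k y 0 (s + 1) i = moment k y 0 s i + moment k y 0 1 i := by
  have hp : Function.Periodic (fun s => k s * y s ^ (i : ℕ)) 1 := fun s => by
    simp only [hkp s, hyp s]
  have h1 := hp.intervalIntegral_add_eq s 0
  have h2 := moment_eq_sub hk hy s (s + 1) i
  rw [moment, h1, zero_add] at h2
  rw [show moment k y 0 1 i = _ from h2]; ring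

/-- Smoothness of moments in the parameter and both endpoints. -/
theorem contDiff_moment_endpoints {k : ℝ → ℝ → ℝ} (hx : ContDiff ℝ ∞ (Function.uncurry x))
    (hk : ContDiff ℝ ∞ (Function.uncurry k)) (i : Fin 3) :
    ContDiff ℝ ∞ (fun v : Fin 3 → ℝ => moment (k (v 0)) (x (v 0)) (v 1) (v 2) i) := by
  have hp := contDiff_primitive (h := fun t s => k t s * x t s ^ (i : ℕ)) (hk.mul (hx.pow _))
  have hb := hp.comp (f := fun v : Fin 3 → ℝ => (v 0, v 2)) (by fun_prop)
  have ha := hp.comp (f := fun v : Fin 3 → ℝ => (v 0, v 1)) (by fun_prop)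
  exact (funext fun v => moment_eq_sub (hk.of_uncurry_apply _).continuous
    (hx.of_uncurry_apply _).continuous _ _ i) ▸ hb.sub ha

theorem SelfMeets.add_one_left (h : IsBaseFamily x f) (hg : IsAdmissible x g) {t a b : ℝ}
    (hab : SelfMeets x g t a b) : SelfMeets x g t (a + 1) b := by
  have hgc := (hg.contDiff.of_uncurry_apply t).continuous
  have hxc := (h.contDiff_x.of_uncurry_apply t).continuous
  refine ⟨(h.periodic t a).trans hab.1, fun i => ?_⟩
  have := hab.2 i
  rw [moment_eq_sub hgc hxc] at this ⊢
  rw [moment_add_one hgc hxc (hg.periodic t) (h.periodic t), hg.moment_eq_zero, add_zero, this]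

theorem SelfMeets.trans {t a b c : ℝ} (h : IsBaseFamily x f) (hg : IsAdmissible x g)
    (hab : SelfMeets x g t a b) (hbc : SelfMeets x g t b c) : SelfMeets x g t a c := by
  have hgc := (hg.contDiff.of_uncurry_apply t).continuous
  have hxc := (h.contDiff_x.of_uncurry_apply t).continuous
  refine ⟨hab.1.trans hbc.1, fun i => ?_⟩
  have h1 := hab.2 i
  have h2 := hbc.2 i
  rw [moment_eq_sub hgc hxc] at h1 h2 ⊢
  linarith

theorem SelfMeets.symm {t a b : ℝ} (hab : SelfMeets x g t a b) : SelfMeets x g t b a := by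
  refine ⟨hab.1.symm, fun i => ?_⟩
  have := hab.2 i
  rw [moment, intervalIntegral.integral_symm]
  exact neg_eq_zero.2 this

theorem selfMeets_add_int (h : IsBaseFamily x f) (hg : IsAdmissible x g) (t a : ℝ) (n : ℤ) :
    SelfMeets x g t a (a + n) := by
  have h0 : ∀ a, SelfMeets x g t a a := fun a => ⟨rfl, fun i => by simp [moment]⟩
  have h1 : ∀ a, SelfMeets x g t a (a + 1) := fun a => ((h0 a).add_one_left h hg).symm
  induction n using Int.induction_on with
  | zero => simpa using h0 a
  | succ n ih =>
    have := ih.trans h hg (h1 _)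
    push_cast at this ⊢
    rwa [add_assoc] at this
  | pred n ih =>
    have e := (h1 (a + (-(n : ℝ) - 1))).symm
    rw [show a + (-(n : ℝ) - 1) + 1 = a + -(n : ℝ) by ring] at e
    push_cast at ih ⊢
    exact ih.trans h hg e

end DoublePoints

section ArcBump

open Real in
/-- A smooth periodic function that is positive exactly on the translates of `(a, b)`. -/
noncomputable def arcBump (a b s : ℝ) : ℝ :=
  expNegInvGlue (cos (2 * π * (s - (a + b) / 2)) - cos (π * (b - a)))

theorem arcBump_contDiff (a b : ℝ) : ContDiff ℝ ∞ (arcBump a b) :=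
  expNegInvGlue.contDiff.comp (by fun_prop)

theorem arcBump_nonneg (a b s : ℝ) : 0 ≤ arcBump a b s := expNegInvGlue.nonneg _

theorem arcBump_periodic (a b : ℝ) : Function.Periodic (arcBump a b) 1 := by
  intro s
  rw [arcBump, arcBump, show 2 * Real.pi * (s + 1 - (a + b) / 2) =
    2 * Real.pi * (s - (a + b) / 2) + 2 * Real.pi by ring, Real.cos_add_two_pi]

open Real in
theorem cos_lt_cos_of_mem_Icc {a b s : ℝ} (hab : b ≤ a + 1) (hs : s ∈ Ioo a b) :
    cos (π * (b - a)) < cos (2 * π * (s - (a + b) / 2)) := by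
  rw [← cos_abs (2 * π * (s - (a + b) / 2))]
  have hpi := pi_pos
  have habs : |s - (a + b) / 2| < (b - a) / 2 := by
    rw [abs_lt]; constructor <;> linarith [hs.1, hs.2]
  have h1 : |2 * π * (s - (a + b) / 2)| = 2 * π * |s - (a + b) / 2| := by
    rw [abs_mul, abs_of_pos (by positivity)]
  rw [h1]
  refine cos_lt_cos_of_nonneg_of_le_pi (by positivity) (by nlinarith) ?_
  nlinarith

theorem arcBump_pos {a b s : ℝ} (hab : b ≤ a + 1) (hs : s ∈ Ioo a b) : 0 < arcBump a b s :=
  expNegInvGlue.pos_of_pos (sub_pos.2 (cos_lt_cos_of_mem_Icc hab hs))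

open Real in
theorem arcBump_eq_zero {a b s : ℝ} (hab : a ≤ b) (hab' : b ≤ a + 1) (hs : s ∈ Icc b (a + 1)) :
    arcBump a b s = 0 := by
  refine expNegInvGlue.zero_of_nonpos ?_
  have h : ∀ s ∈ Ioo b (a + 1), cos (2 * π * (s - (a + b) / 2)) - cos (π * (b - a)) ≤ 0 := by
    intro s hs
    have := cos_lt_cos_of_mem_Icc (by linarith) hs
    rw [show π * (a + 1 - b) = π - π * (b - a) by ring, cos_pi_sub,
      show 2 * π * (s - (b + (a + 1)) / 2) = 2 * π * (s - (a + b) / 2) - π by ring,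
      cos_sub_pi] at this
    linarith
  have hclosed : IsClosed {s | cos (2 * π * (s - (a + b) / 2)) - cos (π * (b - a)) ≤ 0} :=
    isClosed_le (by fun_prop) continuous_const
  rcases eq_or_lt_of_le hab' with hb | hb
  · have hs' : s = b := by
      rw [← hb, Icc_self] at hs; exact hs
    rw [hs', show 2 * π * (b - (a + b) / 2) = π * (b - a) by ring, sub_self]
  · have := closure_minimal h hclosed
    rw [closure_Ioo hb.ne] at this
    exact this hs

end ArcBump

section LocalAnalysis

variable {x f g : ℝ → ℝ → ℝ}

theorem moment_integral_adjacent {k y : ℝ → ℝ} (hk : Continuous k) (hy : Continuous y)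
    (a b c : ℝ) (i : Fin 3) : moment k y a b i + moment k y b c i = moment k y a c i := by
  rw [moment_eq_sub hk hy a b, moment_eq_sub hk hy b c, moment_eq_sub hk hy a c]; ring

/-- Functions with vanishing moments over a period whose moments over an arc form the
identity matrix. -/
theorem IsBaseFamily.exists_dual_moments (h : IsBaseFamily x f) {t a b : ℝ} (hab : a < b)
    (hba : b < a + 1) (h1 : ∃ s ∈ Ioo a b, f t s ≠ 0) (h2 : ∃ s ∈ Ioo b (a + 1), f t s ≠ 0) :
    ∃ k : Fin 3 → ℝ → ℝ, (∀ j, ContDiff ℝ ∞ (k j)) ∧ (∀ j, Function.Periodic (k j) 1) ∧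
      (∀ j i, moment (k j) (x t) 0 1 i = 0) ∧
      ∀ j i, moment (k j) (x t) a b i = if i = j then 1 else 0 := by
  have hfc := (h.contDiff_f.of_uncurry_apply t).continuous
  have hxs := h.contDiff_x.of_uncurry_apply t
  have hxc := hxs.continuous
  have hb1 := arcBump_contDiff a b
  have hb2 := arcBump_contDiff b (a + 1)
  have c1 := exists_polynomial_moment_eq (h.hasDerivAt t) hfc hb1.continuous
    (fun s _ => arcBump_nonneg a b s) (fun s hs _ => (arcBump_pos hba.le hs).ne') h1
  have c2 := exists_polynomial_moment_eq (h.hasDerivAt t) hfc hb2.continuous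
    (fun s _ => arcBump_nonneg b (a + 1) s)
    (fun s hs _ => (arcBump_pos (by linarith) hs).ne') h2
  choose c hc using fun j : Fin 3 => c1 fun i => if i = j then 1 else 0
  choose d hd using fun j : Fin 3 => c2 fun i => if i = j then 1 else 0
  set u : Fin 3 → ℝ → ℝ := fun j s => arcBump a b s * ∑ l : Fin 3, c j l * x t s ^ (l : ℕ)
  set v : Fin 3 → ℝ → ℝ := fun j s =>
    arcBump b (a + 1) s * ∑ l : Fin 3, d j l * x t s ^ (l : ℕ)
  have hu : ∀ j, ContDiff ℝ ∞ (u j) := fun j => by fun_prop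
  have hv : ∀ j, ContDiff ℝ ∞ (v j) := fun j => by fun_prop
  have hper : ∀ j, Function.Periodic (fun s => u j s - v j s) 1 := fun j s => by
    simp only [u, v, arcBump_periodic a b s, arcBump_periodic b (a + 1) s, h.periodic t s]
  have hv0 : ∀ s ∈ Icc a b, arcBump b (a + 1) s = 0 := fun s hs => by
    rw [← arcBump_periodic b (a + 1) s]
    exact arcBump_eq_zero hba.le (by linarith) ⟨by linarith [hs.1], by linarith [hs.2]⟩
  have hM1 : ∀ j i, moment (fun s => u j s - v j s) (x t) a b i = if i = j then 1 else 0 := by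
    intro j i
    rw [moment_congr (l := u j) hab.le (fun s hs => by simp [v, hv0 s hs]) i]
    exact hc j i
  have hM2 : ∀ j i, moment (fun s => u j s - v j s) (x t) b (a + 1) i =
      -(if i = j then 1 else 0) := by
    intro j i
    rw [moment_congr (l := fun s => (-1) * v j s) hba.le
      (fun s hs => by simp [u, arcBump_eq_zero hab.le hba.le hs]) i, moment_const_mul]
    have : moment (v j) (x t) b (a + 1) i = _ := hd j i
    rw [this]; ring
  refine ⟨fun j s => u j s - v j s, fun j => (hu j).sub (hv j), hper, fun j i => ?_, hM1⟩
  have hkc : Continuous fun s => u j s - v j s := ((hu j).sub (hv j)).continuous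
  have e1 := moment_integral_adjacent hkc hxc a b (a + 1) i
  rw [hM1, hM2, moment_eq_sub hkc hxc, moment_add_one hkc hxc (hper j) (h.periodic t)] at e1
  linarith

/-- Near a diagonal point the curve is injective, stably under `C¹`-small perturbations. -/
theorem IsBaseFamily.eventually_eq_of_selfMeets (h : IsBaseFamily x f)
    (hg : ContDiff ℝ ∞ (Function.uncurry g)) (himm : ∀ t s, f t s = 0 → g t s ≠ 0) (t₀ a₀ : ℝ) :
    ∃ ε > 0, ∀ᶠ v : Fin 3 → ℝ in 𝓝 ![t₀, a₀, a₀], ∀ g' : ℝ → ℝ → ℝ, Continuous (g' (v 0)) →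
      (∀ s, |g' (v 0) s - g (v 0) s| < ε) → SelfMeets x g' (v 0) (v 1) (v 2) → v 1 = v 2 := by
  have box : ∀ {P : ℝ → ℝ → Prop}, (∀ᶠ q in 𝓝 (t₀, a₀), P q.1 q.2) →
      ∀ᶠ v : Fin 3 → ℝ in 𝓝 ![t₀, a₀, a₀], ∀ s ∈ uIcc (v 1) (v 2), P (v 0) s := by
    intro P hP
    obtain ⟨r, hr, hball⟩ := Metric.eventually_nhds_iff.1 hP
    have hc : ∀ i : Fin 3, ∀ᶠ v : Fin 3 → ℝ in 𝓝 ![t₀, a₀, a₀],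
        dist (v i) ((![t₀, a₀, a₀] : Fin 3 → ℝ) i) < r := fun i =>
      ((continuous_apply i).dist continuous_const).continuousAt.eventually_lt
        continuousAt_const (by simpa using hr)
    filter_upwards [hc 0, hc 1, hc 2] with v h0 h1 h2 s hs
    refine hball (y := (v 0, s)) ?_
    rw [Prod.dist_eq, max_lt_iff]
    refine ⟨h0, ?_⟩
    simp only [Real.dist_eq, Matrix.cons_val] at h1 h2 ⊢
    rw [abs_lt] at h1 h2 ⊢
    rcases mem_uIcc.1 hs with hs | hs <;> constructor <;> linarith [hs.1, hs.2]
  by_cases hf0 : f t₀ a₀ = 0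
  · have hg0 := himm _ _ hf0
    refine ⟨|g t₀ a₀| / 2, by positivity, ?_⟩
    have hev : ∀ᶠ q : ℝ × ℝ in 𝓝 (t₀, a₀), |g q.1 q.2 - g t₀ a₀| < |g t₀ a₀| / 2 := by
      have : ContinuousAt (fun q : ℝ × ℝ => |g q.1 q.2 - g t₀ a₀|) (t₀, a₀) := by
        have := hg.continuous.continuousAt (x := (t₀, a₀))
        exact (this.sub continuousAt_const).abs
      exact this.eventually_lt continuousAt_const (by simpa using hg0)
    filter_upwards [box (P := fun t s => |g t s - g t₀ a₀| < |g t₀ a₀| / 2) hev]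
      with v hv g' hg' hclose hmeet
    by_contra hne
    have hm := hmeet.2 0
    have hg'ne : ∀ s ∈ uIcc (v 1) (v 2), g' (v 0) s ≠ 0 := by
      intro s hs h0
      have e1 := hv s hs
      have e2 := hclose s
      rw [h0] at e2
      have e3 := abs_sub_abs_le_abs_sub (g t₀ a₀) (g (v 0) s)
      rw [abs_sub_comm] at e3
      rw [zero_sub, abs_neg] at e2
      linarith
    have hF : ∀ s, HasDerivAt (fun s => ∫ r in (v 1)..s, g' (v 0) r) (g' (v 0) s) s := fun s =>
      (hg'.integral_hasStrictDerivAt _ _).hasDerivAt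
    simp only [moment, Fin.val_zero, pow_zero, mul_one] at hm
    rcases lt_or_gt_of_ne hne with hlt | hlt
    · obtain ⟨c, hc, hc'⟩ := exists_hasDerivAt_eq_zero hlt
        (continuous_iff_continuousAt.2 fun s => (hF s).continuousAt).continuousOn
        (by simp [hm]) (fun s _ => hF s)
      exact hg'ne c (by rw [uIcc_of_lt hlt]; exact Ioo_subset_Icc_self hc) hc'
    · obtain ⟨c, hc, hc'⟩ := exists_hasDerivAt_eq_zero hlt
        (continuous_iff_continuousAt.2 fun s => (hF s).continuousAt).continuousOn
        (by simp [hm]) (fun s _ => hF s)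
      exact hg'ne c (by rw [uIcc_of_gt hlt]; exact Ioo_subset_Icc_self hc) hc'
  · refine ⟨1, one_pos, ?_⟩
    have hev : ∀ᶠ q : ℝ × ℝ in 𝓝 (t₀, a₀), f q.1 q.2 ≠ 0 :=
      (h.contDiff_f.continuous.continuousAt (x := (t₀, a₀))).eventually_ne hf0
    filter_upwards [box (P := fun t s => f t s ≠ 0) hev] with v hv g' _ _ hmeet
    by_contra hne
    have hxc := (h.contDiff_x.of_uncurry_apply (v 0)).continuous
    rcases lt_or_gt_of_ne hne with hlt | hlt
    · obtain ⟨c, hc, hc'⟩ := exists_hasDerivAt_eq_zero hlt hxc.continuousOn hmeet.1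
        (fun s _ => h.hasDerivAt (v 0) s)
      exact hv c (by rw [uIcc_of_lt hlt]; exact Ioo_subset_Icc_self hc) hc'
    · obtain ⟨c, hc, hc'⟩ := exists_hasDerivAt_eq_zero hlt hxc.continuousOn hmeet.1.symm
        (fun s _ => h.hasDerivAt (v 0) s)
      exact hv c (by rw [uIcc_of_gt hlt]; exact Ioo_subset_Icc_self hc) hc'

/-- Near a pair of distinct points the curve stays injective under small perturbations. -/
theorem IsBaseFamily.eventually_not_selfMeets (h : IsBaseFamily x f)
    (hg : ContDiff ℝ ∞ (Function.uncurry g)) (v₀ : Fin 3 → ℝ)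
    (hv₀ : ¬ SelfMeets x g (v₀ 0) (v₀ 1) (v₀ 2)) :
    ∃ ε > 0, ∀ᶠ v : Fin 3 → ℝ in 𝓝 v₀, ∀ g' : ℝ → ℝ → ℝ, Continuous (g' (v 0)) →
      (∀ s, |g' (v 0) s - g (v 0) s| < ε) → ¬ SelfMeets x g' (v 0) (v 1) (v 2) := by
  by_cases hx0 : x (v₀ 0) (v₀ 1) = x (v₀ 0) (v₀ 2)
  · obtain ⟨i, hi⟩ : ∃ i, moment (g (v₀ 0)) (x (v₀ 0)) (v₀ 1) (v₀ 2) i ≠ 0 := by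
      by_contra! hc
      exact hv₀ ⟨hx0, hc⟩
    set B : (Fin 3 → ℝ) → ℝ := fun v => |∫ s in (v 1)..(v 2), (|x (v 0) s ^ (i : ℕ)|)|
    have hBc : Continuous B := by
      have hc := continuous_parametric_primitive_of_continuous (a₀ := (0 : ℝ)) (μ := volume)
        (f := fun t s => |x t s ^ (i : ℕ)|) ((h.contDiff_x.continuous.pow (i : ℕ)).abs)
      have h2 := hc.comp (f := fun v : Fin 3 → ℝ => (v 0, v 2)) (by fun_prop)
      have h1 := hc.comp (f := fun v : Fin 3 → ℝ => (v 0, v 1)) (by fun_prop)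
      refine Continuous.abs ((h2.sub h1).congr fun v => ?_)
      have hxc := (h.contDiff_x.of_uncurry_apply (v 0)).continuous
      have hc' : Continuous fun s => |x (v 0) s ^ (i : ℕ)| := by fun_prop
      exact integral_interval_sub_left (hc'.intervalIntegrable _ _) (hc'.intervalIntegrable _ _)
    set m : (Fin 3 → ℝ) → ℝ := fun v => |moment (g (v 0)) (x (v 0)) (v 1) (v 2) i|
    have hmc : Continuous m := (contDiff_moment_endpoints h.contDiff_x hg i).continuous.abs
    have hm0 : 0 < m v₀ := abs_pos.2 hi
    set ε := m v₀ / 2 / (B v₀ + 1)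
    have hB0 : 0 ≤ B v₀ := abs_nonneg _
    refine ⟨ε, by positivity, ?_⟩
    have e1 : ∀ᶠ v in 𝓝 v₀, B v < B v₀ + 1 :=
      hBc.continuousAt.eventually_lt continuousAt_const (by linarith)
    have e2 : ∀ᶠ v in 𝓝 v₀, m v₀ / 2 < m v :=
      continuousAt_const.eventually_lt hmc.continuousAt (by linarith)
    filter_upwards [e1, e2] with v h1 h2 g' hg' hclose hmeet
    have hgc := (hg.of_uncurry_apply (v 0)).continuous
    have hxc := (h.contDiff_x.of_uncurry_apply (v 0)).continuous
    have key : m v ≤ ε * B v := by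
      have hsub := moment_sub hg' hgc hxc (v 1) (v 2) i
      rw [hmeet.2 i, zero_sub] at hsub
      have : m v = |moment (fun s => g' (v 0) s - g (v 0) s) (x (v 0)) (v 1) (v 2) i| := by
        rw [hsub, abs_neg]
      rw [this, show ε * B v = |∫ s in (v 1)..(v 2), ε * (|x (v 0) s ^ (i : ℕ)|)| by
        rw [intervalIntegral.integral_const_mul, abs_mul, abs_of_pos (by positivity)]]
      have hc' : Continuous fun s => ε * |x (v 0) s ^ (i : ℕ)| := by fun_prop
      change ‖∫ s in (v 1)..(v 2), (g' (v 0) s - g (v 0) s) * x (v 0) s ^ (i : ℕ)‖ ≤ _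
      refine intervalIntegral.norm_integral_le_abs_of_norm_le (Eventually.of_forall fun s => ?_)
        (hc'.intervalIntegrable _ _)
      rw [norm_mul]
      exact mul_le_mul_of_nonneg_right (hclose s).le (norm_nonneg _)
    have : ε * B v ≤ ε * (B v₀ + 1) := mul_le_mul_of_nonneg_left h1.le (by positivity)
    have e3 : ε * (B v₀ + 1) = m v₀ / 2 := div_mul_cancel₀ _ (by positivity)
    linarith
  · refine ⟨1, one_pos, ?_⟩
    have hc1 : Continuous fun v : Fin 3 → ℝ => x (v 0) (v 1) :=
      h.contDiff_x.continuous.comp (f := fun v : Fin 3 → ℝ => (v 0, v 1)) (by fun_prop)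
    have hc2 : Continuous fun v : Fin 3 → ℝ => x (v 0) (v 2) :=
      h.contDiff_x.continuous.comp (f := fun v : Fin 3 → ℝ => (v 0, v 2)) (by fun_prop)
    filter_upwards [(isOpen_ne_fun hc1 hc2).mem_nhds hx0] with v hv g' _ _ hmeet
    exact hv hmeet.1

end LocalAnalysis

section LocalTransversality

variable {x f g : ℝ → ℝ → ℝ}

theorem exists_ne_zero_of_integral_eq_zero {f g : ℝ → ℝ} (hg : Continuous g) {a b : ℝ}
    (hab : a < b) (himm : ∀ s, f s = 0 → g s ≠ 0) (hint : ∫ s in a..b, g s = 0) :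
    ∃ s ∈ Ioo a b, f s ≠ 0 := by
  have hF : ∀ s, HasDerivAt (fun s => ∫ r in a..s, g r) (g s) s := fun s =>
    (hg.integral_hasStrictDerivAt _ _).hasDerivAt
  obtain ⟨c, hc, hc'⟩ := exists_hasDerivAt_eq_zero hab
    (continuous_iff_continuousAt.2 fun s => (hF s).continuousAt).continuousOn
    (by simp [hint]) (fun s _ => hF s)
  exact ⟨c, hc, fun h0 => himm c h0 hc'⟩

/-- The moments over the arc from `v 1` to `v 2` of the corrections of `k 0, k 1, k 2`. -/
noncomputable def arcMatrix (x f : ℝ → ℝ → ℝ) (k : Fin 3 → ℝ → ℝ) (v : Fin 3 → ℝ) :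
    Matrix (Fin 3) (Fin 3) ℝ :=
  Matrix.of fun i j => moment (corrected x f (fun _ => k j) (v 0)) (x (v 0)) (v 1) (v 2) i

theorem IsBaseFamily.isAdmissible_corrected_const (h : IsBaseFamily x f) {k : ℝ → ℝ}
    (hk : ContDiff ℝ ∞ k) (hkp : Function.Periodic k 1) :
    IsAdmissible x (corrected x f fun _ => k) :=
  h.isAdmissible_corrected (k := fun _ => k)
    (hk.comp (g := k) (f := fun q : ℝ × ℝ => q.2) contDiff_snd) fun _ => hkp

theorem IsBaseFamily.contDiff_arcMatrix (h : IsBaseFamily x f) {k : Fin 3 → ℝ → ℝ}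
    (hk : ∀ j, ContDiff ℝ ∞ (k j)) (hkp : ∀ j, Function.Periodic (k j) 1) (i j : Fin 3) :
    ContDiff ℝ ∞ fun v => arcMatrix x f k v i j :=
  contDiff_moment_endpoints h.contDiff_x (h.isAdmissible_corrected_const (hk j) (hkp j)).contDiff i

theorem IsBaseFamily.continuous_det_arcMatrix (h : IsBaseFamily x f) {k : Fin 3 → ℝ → ℝ}
    (hk : ∀ j, ContDiff ℝ ∞ (k j)) (hkp : ∀ j, Function.Periodic (k j) 1) :
    Continuous fun v => (arcMatrix x f k v).det :=
  Continuous.matrix_det <| continuous_matrix fun i j => (h.contDiff_arcMatrix hk hkp i j).continuous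

/-- Around any pair of parameters, either a slightly perturbed curve has no double points, or
double points can be resolved by three periodic functions. -/
theorem IsBaseFamily.exists_local_resolution (h : IsBaseFamily x f) (hg : IsAdmissible x g)
    (himm : ∀ t s, f t s = 0 → g t s ≠ 0) {ρ : ℝ → ℝ} (hρ : Continuous ρ)
    (v₀ : Fin 3 → ℝ)
    (hemb : ∀ a b, ρ (v₀ 0) = 0 → SelfMeets x g (v₀ 0) a b → ∃ k : ℤ, b - a = k)
    (h12 : v₀ 1 ≤ v₀ 2) (h21 : v₀ 2 ≤ v₀ 1 + 1) :
    ∃ k : Fin 3 → ℝ → ℝ, (∀ j, ContDiff ℝ ∞ (k j)) ∧ (∀ j, Function.Periodic (k j) 1) ∧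
      ∃ ε > 0, ∀ᶠ v : Fin 3 → ℝ in 𝓝 v₀, ∀ g' : ℝ → ℝ → ℝ, IsAdmissible x g' →
        (∀ s, |g' (v 0) s - g (v 0) s| < ε) → SelfMeets x g' (v 0) (v 1) (v 2) →
        (∃ k : ℤ, v 2 - v 1 = k) ∨ (ρ (v 0) ≠ 0 ∧ (arcMatrix x f k v).det ≠ 0) := by
  have hcont : ∀ {g' : ℝ → ℝ → ℝ}, IsAdmissible x g' → ∀ t, Continuous (g' t) :=
    fun hg' t => (hg'.contDiff.of_uncurry_apply t).continuous
  have hz : (∀ j : Fin 3, ContDiff ℝ ∞ ((fun _ _ => 0 : Fin 3 → ℝ → ℝ) j)) ∧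
      ∀ j : Fin 3, Function.Periodic ((fun _ _ => 0 : Fin 3 → ℝ → ℝ) j) 1 :=
    ⟨fun _ => contDiff_const, fun _ _ => rfl⟩
  by_cases hm : SelfMeets x g (v₀ 0) (v₀ 1) (v₀ 2)
  swap
  · obtain ⟨ε, hε, hev⟩ := h.eventually_not_selfMeets hg.contDiff v₀ hm
    refine ⟨_, hz.1, hz.2, ε, hε, hev.mono fun v hv g' hg' hcl hmeet => ?_⟩
    exact absurd hmeet (hv g' (hcont hg' _) hcl)
  rcases eq_or_lt_of_le h12 with heq | hlt
  · obtain ⟨ε, hε, hev⟩ := h.eventually_eq_of_selfMeets hg.contDiff himm (v₀ 0) (v₀ 1)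
    have hv₀ : v₀ = ![v₀ 0, v₀ 1, v₀ 1] := by
      ext i; fin_cases i <;> simp [heq]
    rw [← hv₀] at hev
    refine ⟨_, hz.1, hz.2, ε, hε, hev.mono fun v hv g' hg' hcl hmeet => ?_⟩
    exact Or.inl ⟨0, by simp [hv g' (hcont hg' _) hcl hmeet]⟩
  rcases eq_or_lt_of_le h21 with heq | hlt'
  · obtain ⟨ε, hε, hev⟩ := h.eventually_eq_of_selfMeets hg.contDiff himm (v₀ 0) (v₀ 2)
    have hT : Tendsto (fun v : Fin 3 → ℝ => ![v 0, v 1 + 1, v 2]) (𝓝 v₀)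
        (𝓝 ![v₀ 0, v₀ 2, v₀ 2]) := by
      have hc : Continuous fun v : Fin 3 → ℝ => ![v 0, v 1 + 1, v 2] := by
        refine continuous_pi fun i => ?_
        fin_cases i <;> simp <;> fun_prop
      have := hc.tendsto v₀
      rwa [← heq] at this
    refine ⟨_, hz.1, hz.2, ε, hε, (hT.eventually hev).mono fun v hv g' hg' hcl hmeet => ?_⟩
    have := hv g' (hcont hg' _) hcl (hmeet.add_one_left h hg')
    simp only [Matrix.cons_val] at this
    exact Or.inl ⟨1, by rw [← this]; simp⟩
  have hρ0 : ρ (v₀ 0) ≠ 0 := by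
    intro h0
    obtain ⟨k, hk⟩ := hemb _ _ h0 hm
    have h1 : (0 : ℝ) < k := by rw [← hk]; linarith
    have h2 : (k : ℝ) < 1 := by rw [← hk]; linarith
    have h1' : (0 : ℤ) < k := by exact_mod_cast h1
    have h2' : k < (1 : ℤ) := by exact_mod_cast h2
    omega
  have hm0 := hm.2 0
  have hm1 := ((hm.add_one_left h hg).symm).2 0
  simp only [moment, Fin.val_zero, pow_zero, mul_one] at hm0 hm1
  obtain ⟨k, hk, hkp, hk0, hk1⟩ := h.exists_dual_moments hlt hlt'
    (exists_ne_zero_of_integral_eq_zero (hcont hg _) hlt (himm _) hm0)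
    (exists_ne_zero_of_integral_eq_zero (hcont hg _) hlt' (himm _) hm1)
  refine ⟨k, hk, hkp, 1, one_pos, ?_⟩
  have hdet : (arcMatrix x f k v₀).det ≠ 0 := by
    have : arcMatrix x f k v₀ = 1 := by
      ext i j
      rw [arcMatrix, Matrix.of_apply, corrected_of_moment_eq_zero (hk0 j), hk1, Matrix.one_apply]
    simp [this]
  filter_upwards [hρ.continuousAt.eventually_ne hρ0 |>.filter_mono
      ((continuous_apply (0 : Fin 3)).tendsto v₀) |> eventually_map.1,
    (h.continuous_det_arcMatrix hk hkp).continuousAt.eventually_ne hdet] with v h1 h2 g' _ _ _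
  exact Or.inr ⟨h1, h2⟩

end LocalTransversality

section NullSets

variable {x f : ℝ → ℝ → ℝ}

theorem volume_level_inter_regular_eq_zero {x f : ℝ → ℝ} (hx : ∀ s, HasDerivAt x (f s) s)
    (c : ℝ) : volume {s | x s = c ∧ f s ≠ 0} = 0 := by
  refine measure_null_of_locally_null _ fun s hs => ⟨{s}, ?_, by simp⟩
  have h1 : ∀ᶠ r in 𝓝[≠] s, x r ≠ c := (hx s).eventually_ne hs.2
  rw [eventually_nhdsWithin_iff] at h1
  rw [mem_nhdsWithin_iff_eventually]
  filter_upwards [h1] with r hr hr'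
  by_contra hne
  exact hr hne hr'.1

/-- Pairs of parameters with equal `x`-coordinate form a null set if almost all critical points
of the `x`-coordinates are removed. -/
theorem IsBaseFamily.volume_equal_coordinate_eq_zero (h : IsBaseFamily x f) {ρ : ℝ → ℝ}
    (hρ : Continuous ρ) (hZ : volume {q : ℝ × ℝ | ρ q.1 ≠ 0 ∧ f q.1 q.2 = 0} = 0) :
    volume {v : Fin 3 → ℝ | ρ (v 0) ≠ 0 ∧ x (v 0) (v 1) = x (v 0) (v 2)} = 0 := by
  have hxc := h.contDiff_x.continuous
  set S : Set (ℝ × (Fin 2 → ℝ)) := {q | ρ q.1 ≠ 0 ∧ x q.1 (q.2 0) = x q.1 (q.2 1)} with hS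
  have hSm : MeasurableSet S := by
    refine MeasurableSet.inter (IsOpen.measurableSet ?_) (IsClosed.measurableSet ?_)
    · exact isOpen_ne_fun (by fun_prop) continuous_const
    · exact isClosed_eq (hxc.comp (f := fun q : ℝ × (Fin 2 → ℝ) => (q.1, q.2 0)) (by fun_prop))
        (hxc.comp (f := fun q : ℝ × (Fin 2 → ℝ) => (q.1, q.2 1)) (by fun_prop))
  have e1 := (volume_preserving_piFinSuccAbove (fun _ : Fin 3 => ℝ) 0).measure_preimage
    (s := S) hSm.nullMeasurableSet
  refine Eq.trans (congrArg _ ?_) (e1.trans ?_)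
  · ext v; rfl
  rw [Measure.volume_eq_prod, Measure.measure_prod_null hSm]
  have hae : ∀ᵐ t : ℝ, ∀ᵐ s : ℝ, ¬ (ρ t ≠ 0 ∧ f t s = 0) := by
    refine Measure.ae_ae_of_ae_prod (p := fun q : ℝ × ℝ => ¬ (ρ q.1 ≠ 0 ∧ f q.1 q.2 = 0)) ?_
    rw [ae_iff, ← Measure.volume_eq_prod]
    simpa using hZ
  filter_upwards [hae] with t ht
  by_cases hρt : ρ t = 0
  · simp [hS, hρt]
  have hft : volume {s | f t s = 0} = 0 := by
    rw [ae_iff] at ht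
    simpa [hρt] using ht
  have hxt : Continuous (x t) := (h.contDiff_x.of_uncurry_apply t).continuous
  set S' : Set (ℝ × ℝ) := {q | x t q.1 = x t q.2} with hS'
  have hSm' : MeasurableSet S' :=
    (isClosed_eq (hxt.comp continuous_fst) (hxt.comp continuous_snd)).measurableSet
  have e2 := (volume_preserving_finTwoArrow ℝ).measure_preimage (s := S') hSm'.nullMeasurableSet
  refine Eq.trans (congrArg _ ?_) (e2.trans ?_)
  · ext u
    simp [hS, hS', hρt, MeasurableEquiv.finTwoArrow]
  rw [Pi.zero_apply, Measure.volume_eq_prod, Measure.measure_prod_null hSm']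
  refine Eventually.of_forall fun a => ?_
  refine measure_mono_null (t := {s | f t s = 0} ∪ {s | x t s = x t a ∧ f t s ≠ 0}) ?_
    (measure_union_null hft (volume_level_inter_regular_eq_zero (h.hasDerivAt t) _))
  intro b hb
  by_cases hb' : f t b = 0
  · exact Or.inl hb'
  · exact Or.inr ⟨hb.symm, hb'⟩

end NullSets

section Perturbation

variable {x f g : ℝ → ℝ → ℝ} {ρ : ℝ → ℝ} {ι : Type*} [Fintype ι]

/-- The perturbation of `g` in the directions `K`, with coefficients `p` and amplitude `ρ`. -/
def perturbed (g : ℝ → ℝ → ℝ) (ρ : ℝ → ℝ) (K : ι → Fin 3 → ℝ → ℝ → ℝ) (p : ι → Fin 3 → ℝ)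
    (t s : ℝ) : ℝ :=
  g t s + ρ t * ∑ τ, ∑ j, p τ j * K τ j t s

theorem moment_perturbed (h : IsBaseFamily x f) (hg : IsAdmissible x g)
    {K : ι → Fin 3 → ℝ → ℝ → ℝ} (hK : ∀ τ j, IsAdmissible x (K τ j)) (p : ι → Fin 3 → ℝ)
    (t a b : ℝ) (i : Fin 3) :
    moment (perturbed g ρ K p t) (x t) a b i = moment (g t) (x t) a b i +
      ρ t * ∑ τ, ∑ j, p τ j * moment (K τ j t) (x t) a b i := by
  have hgc := (hg.contDiff.of_uncurry_apply t).continuous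
  have hxc := (h.contDiff_x.of_uncurry_apply t).continuous
  have hKc : ∀ τ j, Continuous (K τ j t) := fun τ j =>
    ((hK τ j).contDiff.of_uncurry_apply t).continuous
  rw [show perturbed g ρ K p t = fun s => g t s + ρ t * ∑ τ, ∑ j, p τ j * K τ j t s from rfl,
    moment_add hgc (by fun_prop) hxc, moment_const_mul, moment_sum _ (by fun_prop) hxc]
  congr 2
  refine Finset.sum_congr rfl fun τ _ => ?_
  rw [moment_sum _ (by fun_prop) hxc]
  exact Finset.sum_congr rfl fun j _ => moment_const_mul _ _ _ _ _ _

theorem isAdmissible_perturbed (h : IsBaseFamily x f) (hg : IsAdmissible x g)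
    (hρ : ContDiff ℝ ∞ ρ) {K : ι → Fin 3 → ℝ → ℝ → ℝ} (hK : ∀ τ j, IsAdmissible x (K τ j))
    (p : ι → Fin 3 → ℝ) : IsAdmissible x (perturbed g ρ K p) where
  contDiff := by
    refine hg.contDiff.add ((hρ.comp contDiff_fst).mul ?_)
    exact ContDiff.sum fun τ _ => ContDiff.sum fun j _ => contDiff_const.mul (hK τ j).contDiff
  periodic t s := by
    simp only [perturbed, hg.periodic t s, (hK _ _).periodic t s]
  moment_eq_zero t i := by
    rw [moment_perturbed h hg hK]
    simp [hg.moment_eq_zero, (hK _ _).moment_eq_zero]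

/-- Almost no parameter leaves a double point at which the direction `K τ` is transverse. -/
theorem IsBaseFamily.volume_bad_parameters_eq_zero (h : IsBaseFamily x f) (hg : IsAdmissible x g)
    (hρ : ContDiff ℝ ∞ ρ) (hZ : volume {q : ℝ × ℝ | ρ q.1 ≠ 0 ∧ f q.1 q.2 = 0} = 0)
    {K : ι → Fin 3 → ℝ → ℝ → ℝ} (hK : ∀ τ j, IsAdmissible x (K τ j)) (τ : ι) :
    volume {p : ι → Fin 3 → ℝ | ∃ v : Fin 3 → ℝ, ρ (v 0) ≠ 0 ∧
      (Matrix.of fun i j => moment (K τ j (v 0)) (x (v 0)) (v 1) (v 2) i).det ≠ 0 ∧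
      SelfMeets x (perturbed g ρ K p) (v 0) (v 1) (v 2)} = 0 := by
  classical
  set A : (Fin 3 → ℝ) → Matrix (Fin 3) (Fin 3) ℝ := fun v =>
    Matrix.of fun i j => moment (K τ j (v 0)) (x (v 0)) (v 1) (v 2) i with hA
  set r : (ι → Fin 3 → ℝ) → Fin 3 → ℝ := fun π i => -(ρ (π τ 0))⁻¹ *
    (moment (g (π τ 0)) (x (π τ 0)) (π τ 1) (π τ 2) i + ρ (π τ 0) *
      ∑ σ ∈ Finset.univ.erase τ, ∑ j, π σ j * moment (K σ j (π τ 0)) (x (π τ 0)) (π τ 1) (π τ 2) i)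
    with hr
  set Φ : (ι → Fin 3 → ℝ) → ι → Fin 3 → ℝ := fun π =>
    Function.update π τ ((A (π τ))⁻¹.mulVec (r π)) with hΦ
  set S : Set (ι → Fin 3 → ℝ) := {π | ρ (π τ 0) ≠ 0 ∧ (A (π τ)).det ≠ 0 ∧
    x (π τ 0) (π τ 1) = x (π τ 0) (π τ 2)} with hS
  have hmom : ∀ {k : ℝ → ℝ → ℝ}, IsAdmissible x k → ∀ i, ContDiff ℝ ∞
      fun π : ι → Fin 3 → ℝ => moment (k (π τ 0)) (x (π τ 0)) (π τ 1) (π τ 2) i := fun hk i =>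
    (contDiff_moment_endpoints h.contDiff_x hk.contDiff i).comp
      (f := fun π : ι → Fin 3 → ℝ => π τ) (by fun_prop)
  have hSnull : volume S = 0 := by
    refine measure_mono_null (t := Function.eval τ ⁻¹'
      {v : Fin 3 → ℝ | ρ (v 0) ≠ 0 ∧ x (v 0) (v 1) = x (v 0) (v 2)}) ?_
      ((Measure.quasiMeasurePreserving_eval (fun _ : ι => (volume : Measure (Fin 3 → ℝ)))
        τ).preimage_null (h.volume_equal_coordinate_eq_zero hρ.continuous hZ))
    exact fun π hπ => ⟨hπ.1, hπ.2.2⟩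
  have hΦd : DifferentiableOn ℝ Φ S := by
    intro π hπ
    refine DifferentiableAt.differentiableWithinAt ?_
    refine differentiableAt_pi.2 fun σ => differentiableAt_pi.2 fun i => ?_
    by_cases hσ : σ = τ
    · subst hσ
      simp only [hΦ, Function.update_self]
      refine (contDiff_inv_mulVec (n := ∞) (A := fun π : ι → Fin 3 → ℝ => A (π σ)) (b := r)
        (fun i j => (hmom (hK σ j) i).contDiffAt) (fun i => ?_) hπ.2.1 i).differentiableAt
        (by simp)
      have hρπ : ContDiff ℝ ∞ fun π : ι → Fin 3 → ℝ => ρ (π σ 0) :=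
        hρ.comp (f := fun π : ι → Fin 3 → ℝ => π σ 0) (by fun_prop)
      refine ((hρπ.contDiffAt.inv hπ.1).neg).mul (ContDiff.contDiffAt ?_)
      refine (hmom hg i).add (hρπ.mul ?_)
      exact ContDiff.sum fun σ' _ => ContDiff.sum fun j _ =>
        ContDiff.mul (by fun_prop) (hmom (hK σ' j) i)
    · simp only [hΦ, Function.update_of_ne hσ]
      fun_prop
  refine measure_mono_null ?_
    (addHaar_image_eq_zero_of_differentiableOn_of_addHaar_eq_zero volume hΦd hSnull)
  rintro p ⟨v, hρv, hdet, hmeet⟩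
  refine ⟨Function.update p τ v, ⟨by simpa using hρv, by simpa [hA] using hdet,
    by simpa using hmeet.1⟩, ?_⟩
  have hsolve : (A v)⁻¹.mulVec (r (Function.update p τ v)) = p τ := by
    have : r (Function.update p τ v) = (A v).mulVec (p τ) := by
      funext i
      have e := hmeet.2 i
      rw [moment_perturbed h hg hK, ← Finset.add_sum_erase _ _ (Finset.mem_univ τ)] at e
      have e3 : ∑ σ ∈ Finset.univ.erase τ, ∑ j, Function.update p τ v σ j *
          moment (K σ j (v 0)) (x (v 0)) (v 1) (v 2) i = ∑ σ ∈ Finset.univ.erase τ, ∑ j, p σ j *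
          moment (K σ j (v 0)) (x (v 0)) (v 1) (v 2) i := by
        refine Finset.sum_congr rfl fun σ hσ => ?_
        rw [Function.update_of_ne (Finset.ne_of_mem_erase hσ)]
      have e4 : (A v).mulVec (p τ) i =
          ∑ j, p τ j * moment (K τ j (v 0)) (x (v 0)) (v 1) (v 2) i := by
        simp only [Matrix.mulVec, dotProduct, hA, Matrix.of_apply, mul_comm]
      simp only [hr, Function.update_self, e3]
      rw [e4]
      field_simp
      linarith
    rw [this, Matrix.mulVec_mulVec, Matrix.nonsing_inv_mul _ hdet.isUnit, Matrix.one_mulVec]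
  simp only [hΦ, Function.update_self, hsolve, Function.update_idem, Function.update_eq_self]

end Perturbation

section Embedding

variable {x f g : ℝ → ℝ → ℝ} {ρ : ℝ → ℝ}

theorem isCompact_doublePointDomain : IsCompact {v : Fin 3 → ℝ |
    v 0 ∈ Icc (0 : ℝ) 1 ∧ v 1 ∈ Icc (0 : ℝ) 1 ∧ v 1 ≤ v 2 ∧ v 2 ≤ v 1 + 1} := by
  refine (isCompact_univ_pi (s := fun _ : Fin 3 => Icc (0 : ℝ) 2)
    fun _ => isCompact_Icc).of_isClosed_subset ?_ ?_
  · simp only [mem_Icc, ofPred_and]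
    refine IsClosed.inter (IsClosed.inter ?_ ?_) (IsClosed.inter (IsClosed.inter ?_ ?_)
      (IsClosed.inter ?_ ?_)) <;> exact isClosed_le (by fun_prop) (by fun_prop)
  · rintro v ⟨⟨h1, h2⟩, ⟨h3, h4⟩, h5, h6⟩ i -
    fin_cases i <;> constructor <;> simp <;> linarith

/-- Translating the endpoints by integers moves a double point into the fundamental domain. -/
theorem SelfMeets.exists_mem_Icc (h : IsBaseFamily x f) (hg : IsAdmissible x g) {t a b : ℝ}
    (hab : SelfMeets x g t a b) : ∃ a' b', a' ∈ Icc (0 : ℝ) 1 ∧ a' ≤ b' ∧ b' ≤ a' + 1 ∧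
      SelfMeets x g t a' b' ∧ ((∃ k : ℤ, b' - a' = k) → ∃ k : ℤ, b - a = k) := by
  refine ⟨a + (-⌊a⌋ : ℤ), b + (-⌊a⌋ - ⌊b - a⌋ : ℤ), ?_, ?_, ?_, ?_, ?_⟩
  · push_cast
    exact ⟨by linarith [Int.floor_le a], by linarith [Int.lt_floor_add_one a]⟩
  · push_cast
    linarith [Int.floor_le (b - a)]
  · push_cast
    linarith [Int.lt_floor_add_one (b - a)]
  · exact ((selfMeets_add_int h hg t a _).symm.trans h hg hab).trans h hg
      (selfMeets_add_int h hg t b _)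
  · rintro ⟨k, hk⟩
    refine ⟨k + ⌊b - a⌋, ?_⟩
    push_cast at hk ⊢
    linarith

/-- A smooth family of closed immersed horizontal curves can be perturbed, relative to the
parameters with `ρ t = 0`, to a family of embedded curves. -/
theorem IsBaseFamily.exists_embedded (h : IsBaseFamily x f) (hg : IsAdmissible x g)
    (himm : ∀ t s, f t s = 0 → g t s ≠ 0) (hρ : ContDiff ℝ ∞ ρ)
    (hemb : ∀ t ∈ Icc (0 : ℝ) 1, ρ t = 0 → ∀ a b, SelfMeets x g t a b → ∃ k : ℤ, b - a = k)
    (hZ : volume {q : ℝ × ℝ | ρ q.1 ≠ 0 ∧ f q.1 q.2 = 0} = 0) :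
    ∃ g' : ℝ → ℝ → ℝ, IsAdmissible x g' ∧ (∀ t, ρ t = 0 → g' t = g t) ∧
      (∀ t ∈ Icc (0 : ℝ) 1, ∀ s, f t s = 0 → 0 < g' t s * g t s) ∧
      ∀ t ∈ Icc (0 : ℝ) 1, ∀ a b, SelfMeets x g' t a b → ∃ k : ℤ, b - a = k := by
  set D : Set (Fin 3 → ℝ) :=
    {v | v 0 ∈ Icc (0 : ℝ) 1 ∧ v 1 ∈ Icc (0 : ℝ) 1 ∧ v 1 ≤ v 2 ∧ v 2 ≤ v 1 + 1} with hD
  choose! k hk hkp ε hε hev using fun (v : Fin 3 → ℝ) (hv : v ∈ D) =>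
    h.exists_local_resolution hg himm hρ.continuous v (fun a b h0 => hemb _ hv.1 h0 a b)
      hv.2.2.1 hv.2.2.2
  obtain ⟨F, hFD, hcover⟩ := isCompact_doublePointDomain.elim_nhds_subcover _ hev
  set K : F → Fin 3 → ℝ → ℝ → ℝ := fun τ j => corrected x f fun _ => k τ j with hKdef
  have hK : ∀ τ j, IsAdmissible x (K τ j) := fun τ j =>
    h.isAdmissible_corrected_const (hk τ (hFD τ τ.2) j) (hkp τ (hFD τ τ.2) j)
  have hsq : IsCompact (Icc (0 : ℝ) 1 ×ˢ Icc (0 : ℝ) 1) := isCompact_Icc.prod isCompact_Icc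
  obtain ⟨η, hη, hηfg⟩ : ∃ η > 0, ∀ q ∈ Icc (0 : ℝ) 1 ×ˢ Icc (0 : ℝ) 1,
      η ≤ |f q.1 q.2| + |g q.1 q.2| := by
    obtain ⟨q, -, hq⟩ := hsq.exists_isMinOn ⟨(0, 0), by simp⟩
      (h.contDiff_f.continuous.abs.add hg.contDiff.continuous.abs).continuousOn
    refine ⟨|f q.1 q.2| + |g q.1 q.2|, ?_, fun q' hq' => hq hq'⟩
    by_cases h0 : f q.1 q.2 = 0
    · have := abs_pos.2 (himm _ _ h0); positivity
    · have := abs_pos.2 h0; positivity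
  obtain ⟨δ, hδ0, hδη, hδε⟩ : ∃ δ : ℝ, 0 < δ ∧ δ < η ∧ ∀ τ : F, δ < ε τ := by
    have e1 : ∀ᶠ δ : ℝ in 𝓝[>] 0, ∀ τ : F, δ < ε τ := eventually_all.2 fun τ =>
      eventually_nhdsWithin_of_eventually_nhds (eventually_lt_nhds (hε τ (hFD τ τ.2)))
    have e2 : ∀ᶠ δ : ℝ in 𝓝[>] 0, δ < η :=
      eventually_nhdsWithin_of_eventually_nhds (eventually_lt_nhds hη)
    obtain ⟨δ, h1, h2, h3⟩ := (e1.and (e2.and self_mem_nhdsWithin)).exists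
    exact ⟨δ, h3, h2, h1⟩
  have hsmall : ∀ᶠ p : F → Fin 3 → ℝ in 𝓝 0, ∀ q ∈ Icc (0 : ℝ) 1 ×ˢ Icc (0 : ℝ) 1,
      |perturbed g ρ K p q.1 q.2 - g q.1 q.2| < δ := by
    refine hsq.eventually_forall_of_forall_eventually fun q _ => ?_
    have hc : Continuous fun z : (F → Fin 3 → ℝ) × ℝ × ℝ =>
        |perturbed g ρ K z.1 z.2.1 z.2.2 - g z.2.1 z.2.2| := by
      have hgc : Continuous fun z : (F → Fin 3 → ℝ) × ℝ × ℝ => g z.2.1 z.2.2 :=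
        hg.contDiff.continuous.comp continuous_snd
      have hKc : ∀ τ j, Continuous fun z : (F → Fin 3 → ℝ) × ℝ × ℝ => K τ j z.2.1 z.2.2 :=
        fun τ j => (hK τ j).contDiff.continuous.comp continuous_snd
      have hρc := hρ.continuous
      exact ((hgc.add ((hρc.comp (continuous_fst.comp continuous_snd)).mul
        (continuous_finsetSum _ fun τ _ => continuous_finsetSum _ fun j _ =>
          Continuous.mul (by fun_prop) (hKc τ j)))).sub hgc).abs
    exact hc.continuousAt.eventually_lt continuousAt_const (by simpa [perturbed] using hδ0)
  have hgood : ∀ᵐ p : F → Fin 3 → ℝ, ∀ τ : F, ¬ ∃ v : Fin 3 → ℝ, ρ (v 0) ≠ 0 ∧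
      (arcMatrix x f (k τ) v).det ≠ 0 ∧
      SelfMeets x (perturbed g ρ K p) (v 0) (v 1) (v 2) := by
    refine ae_all_iff.2 fun τ => ?_
    rw [ae_iff]
    simp only [not_not]
    exact h.volume_bad_parameters_eq_zero hg hρ hZ hK τ
  obtain ⟨p, hpgood, hpsmall⟩ := (Measure.dense_of_ae hgood).inter_nhds_nonempty hsmall
  have hg' := isAdmissible_perturbed h hg hρ hK p
  have hclose : ∀ t ∈ Icc (0 : ℝ) 1, ∀ s, |perturbed g ρ K p t s - g t s| < δ := by
    intro t ht s
    have hper : Function.Periodic (fun s => |perturbed g ρ K p t s - g t s|) 1 := fun s => by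
      simp only [hg'.periodic t s, hg.periodic t s]
    obtain ⟨r, hr, hrs⟩ := hper.exists_mem_Ico₀ one_pos s
    exact hrs.trans_lt (hpsmall (t, r) ⟨ht, hr.1, hr.2.le⟩)
  refine ⟨perturbed g ρ K p, hg', fun t ht => ?_, fun t ht s hs => ?_, fun t ht a b hab => ?_⟩
  · funext s; simp [perturbed, ht]
  · have h1 := hclose t ht s
    have h2 : η ≤ |g t s| := by
      have hper : Function.Periodic (fun s => |f t s| + |g t s|) 1 := fun s => by
        simp only [h.periodic_f t s, hg.periodic t s]
      obtain ⟨r, hr, hrs⟩ := hper.exists_mem_Ico₀ one_pos s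
      have := hηfg (t, r) ⟨ht, hr.1, hr.2.le⟩
      simp only at hrs this
      rw [← hrs, hs, abs_zero, zero_add] at this
      exact this
    rw [abs_lt] at h1
    rcases le_total 0 (g t s) with h0 | h0
    · rw [abs_of_nonneg h0] at h2
      exact mul_pos (by linarith) (by linarith)
    · rw [abs_of_nonpos h0] at h2
      exact mul_pos_of_neg_of_neg (by linarith) (by linarith)
  · obtain ⟨a', b', ha', hab1, hab2, hmeet, himp⟩ := hab.exists_mem_Icc h hg'
    refine himp ?_
    have hv : ![t, a', b'] ∈ D := ⟨ht, ha', hab1, hab2⟩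
    obtain ⟨τ, hτ, hvτ⟩ := mem_iUnion₂.1 (hcover hv)
    rcases hvτ _ hg' (fun s => (hclose t ht s).trans (hδε ⟨τ, hτ⟩)) hmeet with hint | hdet
    · exact hint
    · exact absurd ⟨_, hdet.1, hdet.2, hmeet⟩ (hpgood ⟨τ, hτ⟩)

end Embedding

section Winding

/-- The closed plane curve `A` has a continuous angle function that increases by `2πn` over a
period. -/
def HasWindingNumber (A : ℝ → ℂ) (n : ℤ) : Prop :=
  ∃ θ : ℝ → ℝ, Continuous θ ∧ (∀ s, A s = ‖A s‖ * Complex.exp (θ s * Complex.I)) ∧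
    θ 1 - θ 0 = 2 * Real.pi * (n : ℝ)

/-- The velocity of the projection of a curve to the `(x, y)`-plane. -/
noncomputable def velocity (γ : ℝ → ℝ × ℝ × ℝ × ℝ) (s : ℝ) : ℂ :=
  ⟨deriv (fun t => (γ t).1) s, deriv (fun t => (γ t).2.1) s⟩

theorem eq_norm_mul_exp_iff (a b θ : ℝ) :
    (⟨a, b⟩ : ℂ) = ‖(⟨a, b⟩ : ℂ)‖ * Complex.exp (θ * Complex.I) ↔
      a = Real.sqrt (a ^ 2 + b ^ 2) * Real.cos θ ∧ b = Real.sqrt (a ^ 2 + b ^ 2) * Real.sin θ := by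
  rw [Complex.norm_eq_sqrt_sq_add_sq, Complex.ext_iff, Complex.re_ofReal_mul,
    Complex.im_ofReal_mul, Complex.exp_ofReal_mul_I_re, Complex.exp_ofReal_mul_I_im]

theorem hasRotationNumber_iff (γ : ℝ → ℝ × ℝ × ℝ × ℝ) (n : ℤ) :
    HasRotationNumber γ n ↔ HasWindingNumber (velocity γ) n := by
  simp only [HasRotationNumber, HasWindingNumber, velocity, eq_norm_mul_exp_iff]

theorem eq_of_forall_exp_mul_I_eq_one {δ : ℝ → ℝ} (hδ : Continuous δ)
    (h : ∀ s, Complex.exp (δ s * Complex.I) = 1) (a b : ℝ) : δ a = δ b := by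
  have hsub : range δ ⊆ range fun n : ℤ => (n : ℝ) * (2 * Real.pi) := by
    rintro _ ⟨s, rfl⟩
    obtain ⟨n, hn⟩ := Complex.exp_eq_one_iff.1 (h s)
    refine ⟨n, ?_⟩
    have : ((δ s : ℝ) : ℂ) = ((n * (2 * Real.pi) : ℝ) : ℂ) := by
      refine mul_right_cancel₀ Complex.I_ne_zero (hn.trans ?_)
      push_cast; ring
    exact (Complex.ofReal_injective this).symm
  exact ((countable_range _).mono hsub).isTotallyDisconnected _ Subset.rfl
    (isPreconnected_range hδ) (mem_range_self a) (mem_range_self b)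

theorem HasWindingNumber.unique {A : ℝ → ℂ} {m n : ℤ} (h0 : ∀ s, A s ≠ 0)
    (hm : HasWindingNumber A m) (hn : HasWindingNumber A n) : m = n := by
  obtain ⟨θ, hθ, hA, hθm⟩ := hm
  obtain ⟨φ, hφ, hB, hφn⟩ := hn
  have key := eq_of_forall_exp_mul_I_eq_one (hθ.sub hφ) (fun s => by
    rw [Pi.sub_apply, Complex.ofReal_sub, sub_mul, Complex.exp_sub,
      div_eq_one_iff_eq (Complex.exp_ne_zero _)]
    have hne : (‖A s‖ : ℂ) ≠ 0 := by simpa using h0 s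
    exact mul_left_cancel₀ hne ((hA s).symm.trans (hB s))) 0 1
  have : 2 * Real.pi * (m : ℝ) = 2 * Real.pi * n := by
    rw [← hθm, ← hφn]; simp only [Pi.sub_apply] at key; linarith
  exact_mod_cast mul_left_cancel₀ (by positivity) this

/-- Closed curves that are nowhere antiparallel have equal winding numbers. -/
theorem HasWindingNumber.of_div_mem_slitPlane {A B : ℝ → ℂ} {n : ℤ} (hA : HasWindingNumber A n)
    (hAc : Continuous A) (hBc : Continuous B) (hAp : Function.Periodic A 1)
    (hBp : Function.Periodic B 1) (hAB : ∀ s, B s / A s ∈ Complex.slitPlane) :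
    HasWindingNumber B n := by
  obtain ⟨θ, hθ, hAθ, hn⟩ := hA
  have hA0 : ∀ s, A s ≠ 0 := fun s h0 => Complex.slitPlane_ne_zero (hAB s) (by simp [h0])
  refine ⟨fun s => (B s / A s).arg + θ s, ?_, fun s => ?_, ?_⟩
  · refine Continuous.add (continuous_iff_continuousAt.2 fun s => ?_) hθ
    exact (Complex.continuousAt_arg (hAB s)).comp
      (f := fun s => B s / A s) (hBc.continuousAt.div hAc.continuousAt (hA0 s))
  · have e1 := Complex.norm_mul_exp_arg_mul_I (B s / A s)
    have hne : ‖A s‖ ≠ 0 := by simpa using hA0 s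
    calc B s = B s / A s * A s := (div_mul_cancel₀ _ (hA0 s)).symm
      _ = (‖B s / A s‖ * Complex.exp ((B s / A s).arg * Complex.I)) *
          (‖A s‖ * Complex.exp (θ s * Complex.I)) := by rw [e1, ← hAθ s]
      _ = ((‖B s / A s‖ * ‖A s‖ : ℝ) : ℂ) * (Complex.exp ((B s / A s).arg * Complex.I) *
          Complex.exp (θ s * Complex.I)) := by push_cast; ring
      _ = _ := by
        rw [norm_div, div_mul_cancel₀ _ hne, ← Complex.exp_add]
        push_cast; ring_nf
  · have h1 := hAp 0
    have h2 := hBp 0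
    rw [zero_add] at h1 h2
    simp only [h1, h2]; linarith

theorem inv_mem_slitPlane {z : ℂ} (hz : z ∈ Complex.slitPlane) : z⁻¹ ∈ Complex.slitPlane := by
  have h0 := Complex.normSq_pos.2 (Complex.slitPlane_ne_zero hz)
  rw [Complex.mem_slitPlane_iff] at hz ⊢
  rw [Complex.inv_re, Complex.inv_im]
  rcases hz with h | h
  · exact Or.inl (by positivity)
  · exact Or.inr (div_ne_zero (neg_ne_zero.2 h) h0.ne')

/-- The winding number is constant in continuous families of closed curves avoiding `0`. -/
theorem HasWindingNumber.of_family {A : ℝ → ℝ → ℂ} {n : ℤ}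
    (hA : Continuous (Function.uncurry A)) (hp : ∀ t, Function.Periodic (A t) 1)
    (h0 : ∀ t s, A t s ≠ 0) {t₀ : ℝ} (hn : HasWindingNumber (A t₀) n) (t₁ : ℝ) :
    HasWindingNumber (A t₁) n := by
  have hc : ∀ t, Continuous (A t) := fun t =>
    hA.comp (f := fun s : ℝ => (t, s)) (by fun_prop)
  have key : ∀ t, ∀ᶠ r in 𝓝 t, ∀ s, A r s / A t s ∈ Complex.slitPlane := by
    intro t
    have : ∀ᶠ r in 𝓝 t, ∀ s ∈ Icc (0 : ℝ) 1, A r s / A t s ∈ Complex.slitPlane := by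
      refine isCompact_Icc.eventually_forall_of_forall_eventually fun s _ => ?_
      have hcont : Continuous fun z : ℝ × ℝ => A z.1 z.2 / A t z.2 :=
        hA.div ((hc t).comp continuous_snd) fun z => h0 t z.2
      refine hcont.continuousAt.eventually (Complex.isOpen_slitPlane.mem_nhds ?_)
      simp only [div_self (h0 t s), Complex.one_mem_slitPlane]
    filter_upwards [this] with r hr s
    have hper : Function.Periodic (fun s => A r s / A t s) 1 := fun s => by
      simp only [hp r s, hp t s]
    obtain ⟨s', hs', he⟩ := hper.exists_mem_Ico₀ one_pos s
    exact (congrArg (· ∈ Complex.slitPlane) he).mpr (hr s' ⟨hs'.1, hs'.2.le⟩)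
  have hclopen : IsClopen {t | HasWindingNumber (A t) n} := by
    constructor
    · rw [← isOpen_compl_iff, isOpen_iff_mem_nhds]
      intro t ht
      filter_upwards [key t] with r hr hrn
      refine ht (hrn.of_div_mem_slitPlane (hc r) (hc t) (hp r) (hp t) fun s => ?_)
      rw [← inv_div]
      exact inv_mem_slitPlane (hr s)
    · rw [isOpen_iff_mem_nhds]
      intro t ht
      filter_upwards [key t] with r hr
      exact HasWindingNumber.of_div_mem_slitPlane ht (hc t) (hc r) (hp t) (hp r) hr
  exact Set.eq_univ_iff_forall.1 (hclopen.eq_univ ⟨t₀, hn⟩) t₁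

theorem IsHorizontalLoop.velocity_ne_zero {γ : ℝ → ℝ × ℝ × ℝ × ℝ} (h : IsHorizontalLoop γ)
    (s : ℝ) : velocity γ s ≠ 0 := by
  intro h0
  have hx : deriv (fun t => (γ t).1) s = 0 := congrArg Complex.re h0
  have hy : deriv (fun t => (γ t).2.1) s = 0 := congrArg Complex.im h0
  have hz := h.tangent_z s
  have hw := h.tangent_w s
  rw [hx, mul_zero] at hz hw
  have hd : DifferentiableAt ℝ γ s := h.smooth.differentiable (by simp) s
  have d1 := (hd.fst).hasDerivAt
  have d2 := (hd.snd.fst).hasDerivAt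
  have d3 := (hd.snd.snd.fst).hasDerivAt
  have d4 := (hd.snd.snd.snd).hasDerivAt
  rw [hx] at d1
  rw [hy] at d2
  rw [hz] at d3
  rw [hw] at d4
  exact h.immersed s (d1.prodMk (d2.prodMk (d3.prodMk d4))).deriv

theorem IsHorizontalLoop.velocity_periodic {γ : ℝ → ℝ × ℝ × ℝ × ℝ} (h : IsHorizontalLoop γ) :
    Function.Periodic (velocity γ) 1 := by
  intro s
  have e1 := deriv_comp_add_const (fun t => (γ t).1) 1 s
  have e2 := deriv_comp_add_const (fun t => (γ t).2.1) 1 s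
  simp only [h.periodic _] at e1 e2
  rw [velocity, velocity, ← e1, ← e2]

/-- Rotation numbers are invariant under horizontal isotopy. -/
theorem IsHorizontalIsotopy.hasWindingNumber {H : ℝ → ℝ → ℝ × ℝ × ℝ × ℝ}
    (h : IsHorizontalIsotopy H) {n : ℤ} (hn : HasWindingNumber (velocity (H 0)) n) :
    HasWindingNumber (velocity (H 1)) n := by
  set S : Set (ℝ × ℝ) := Icc (0 : ℝ) 1 ×ˢ univ with hS
  have hud : UniqueDiffOn ℝ S := (uniqueDiffOn_Icc zero_lt_one).prod uniqueDiffOn_univ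
  set G : ℝ × ℝ → ℝ × ℝ × ℝ × ℝ := fun q =>
    fderivWithin ℝ (Function.uncurry H) S q ((0 : ℝ), (1 : ℝ)) with hG
  have hGc : ContinuousOn G S :=
    (h.1.continuousOn_fderivWithin hud (by simp)).clm_apply continuousOn_const
  have hvel : ∀ t ∈ Icc (0 : ℝ) 1, ∀ s, velocity (H t) s = ⟨(G (t, s)).1, (G (t, s)).2.1⟩ := by
    intro t ht s
    have hd : HasFDerivWithinAt (Function.uncurry H) (fderivWithin ℝ (Function.uncurry H) S (t, s))
        S (t, s) :=
      (h.1.differentiableOn (by simp) (t, s) ⟨ht, mem_univ _⟩).hasFDerivWithinAt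
    have hpath : HasDerivWithinAt (fun r : ℝ => (t, r)) ((0 : ℝ), (1 : ℝ)) univ s :=
      ((hasDerivAt_const s t).prodMk (hasDerivAt_id s)).hasDerivWithinAt
    have hd' : HasDerivAt (H t) (G (t, s)) s :=
      hasDerivWithinAt_univ.1
        (hd.comp_hasDerivWithinAt s hpath fun r _ => ⟨ht, mem_univ _⟩)
    have d1 : deriv (fun r => (H t r).1) s = (G (t, s)).1 :=
      (((ContinuousLinearMap.fst ℝ ℝ (ℝ × ℝ × ℝ)).hasFDerivAt).comp_hasDerivAt s hd').deriv
    have d2 : deriv (fun r => (H t r).2.1) s = (G (t, s)).2.1 :=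
      (((ContinuousLinearMap.fst ℝ ℝ (ℝ × ℝ)).comp
        (ContinuousLinearMap.snd ℝ ℝ (ℝ × ℝ × ℝ))).hasFDerivAt.comp_hasDerivAt s hd').deriv
    rw [velocity, d1, d2]
  set c : ℝ → ℝ := fun t => projIcc 0 1 zero_le_one t with hc
  have hcm : ∀ t, c t ∈ Icc (0 : ℝ) 1 := fun t => (projIcc 0 1 zero_le_one t).2
  have hcc : Continuous c := continuous_subtype_val.comp continuous_projIcc
  have hc0 : c 0 = 0 := by simp [hc]
  have hc1 : c 1 = 1 := by simp [hc]
  have hA : Continuous (Function.uncurry fun t => velocity (H (c t))) := by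
    have hGc' : Continuous fun q : ℝ × ℝ => G (c q.1, q.2) :=
      hGc.comp_continuous (by fun_prop) fun q => ⟨hcm _, mem_univ _⟩
    have : (Function.uncurry fun t => velocity (H (c t))) = fun q : ℝ × ℝ =>
        ((G (c q.1, q.2)).1 : ℂ) + ((G (c q.1, q.2)).2.1 : ℂ) * Complex.I := by
      funext q
      simp only [Function.uncurry, hvel _ (hcm q.1), Complex.mk_eq_add_mul_I]
    rw [this]
    exact (Complex.continuous_ofReal.comp (continuous_fst.comp hGc')).add
      ((Complex.continuous_ofReal.comp (continuous_fst.comp (continuous_snd.comp hGc'))).mul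
        continuous_const)
  have := HasWindingNumber.of_family (A := fun t => velocity (H (c t))) hA
    (fun t => (h.2 _ (hcm t)).velocity_periodic) (fun t => (h.2 _ (hcm t)).velocity_ne_zero)
    (t₀ := 0) (n := n) (by rwa [hc0]) 1
  rwa [hc1] at this

end Winding

section Lift

/-- Two points of a horizontal curve agree iff the `x`-coordinates agree and the moments of `y'`
between them vanish. -/
theorem horizontal_eq_iff {x y z w f g : ℝ → ℝ} (hx : ∀ s, HasDerivAt x (f s) s)
    (hy : ∀ s, HasDerivAt y (g s) s) (hz : ∀ s, HasDerivAt z (y s * f s) s)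
    (hw : ∀ s, HasDerivAt w (z s * f s) s) (hg : Continuous g) (a b : ℝ) :
    (x a, y a, z a, w a) = (x b, y b, z b, w b) ↔ x a = x b ∧ ∀ i, moment g x a b i = 0 := by
  have hxc : Continuous x := continuous_iff_continuousAt.2 fun s => (hx s).continuousAt
  have m0 : moment g x a b 0 = y b - y a :=
    integral_eq_sub_of_hasDerivAt (fun s _ => by simpa using hy s)
      (Continuous.intervalIntegrable (by fun_prop) _ _)
  have m1 : moment g x a b 1 = (y b * x b - z b) - (y a * x a - z a) := by
    refine integral_eq_sub_of_hasDerivAt (f := fun s => y s * x s - z s) (fun s _ => ?_)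
      (Continuous.intervalIntegrable (by fun_prop) _ _)
    exact (((hy s).mul (hx s)).sub (hz s)).congr_deriv (by simp)
  have m2 : moment g x a b 2 = (2 * w b - 2 * (z b * x b) + y b * x b ^ 2) -
      (2 * w a - 2 * (z a * x a) + y a * x a ^ 2) := by
    refine integral_eq_sub_of_hasDerivAt
      (f := fun s => 2 * w s - 2 * (z s * x s) + y s * x s ^ 2) (fun s _ => ?_)
      (Continuous.intervalIntegrable (by fun_prop) _ _)
    refine ((((hw s).const_mul 2).sub (((hz s).mul (hx s)).const_mul 2)).add
      ((hy s).mul ((hx s).pow 2))).congr_deriv ?_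
    simp only [Pi.pow_apply, Fin.val_two, Nat.cast_ofNat]
    ring
  constructor
  · intro h
    simp only [Prod.mk.injEq] at h
    obtain ⟨h1, h2, h3, h4⟩ := h
    refine ⟨h1, fun i => ?_⟩
    fin_cases i
    · simpa [m0] using sub_eq_zero.2 h2.symm
    · simp [m1, h1, h2, h3]
    · simp [m2, h1, h2, h3, h4]
  · rintro ⟨h1, h2⟩
    have e0 := h2 0
    have e1 := h2 1
    have e2 := h2 2
    rw [m0] at e0
    rw [m1] at e1
    rw [m2] at e2
    have hy' : y a = y b := by linarith
    have hz' : z a = z b := by rw [h1, hy'] at e1; linarith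
    have hw' : w a = w b := by rw [h1, hy', hz'] at e2; linarith
    simp only [h1, hy', hz', hw']

/-- The primitive of `h t` with initial value `c t`. -/
noncomputable def primitive (c : ℝ → ℝ) (h : ℝ → ℝ → ℝ) (t s : ℝ) : ℝ :=
  c t + ∫ σ in (0 : ℝ)..s, h t σ

theorem contDiff_uncurry_primitive {c : ℝ → ℝ} {h : ℝ → ℝ → ℝ} (hc : ContDiff ℝ ∞ c)
    (hh : ContDiff ℝ ∞ (Function.uncurry h)) : ContDiff ℝ ∞ (Function.uncurry (primitive c h)) :=
  (hc.comp contDiff_fst).add (contDiff_primitive hh)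

theorem hasDerivAt_primitive (c : ℝ → ℝ) {h : ℝ → ℝ → ℝ}
    (hh : ContDiff ℝ ∞ (Function.uncurry h)) (t s : ℝ) :
    HasDerivAt (primitive c h t) (h t s) s :=
  (((hh.of_uncurry_apply t).continuous.integral_hasStrictDerivAt 0 s).hasDerivAt).const_add _

/-- A function with derivative `h t` is the primitive of `h t` with its own initial value. -/
theorem primitive_eq {c : ℝ → ℝ} {h : ℝ → ℝ → ℝ} {t : ℝ} {u : ℝ → ℝ} (hc : c t = u 0)
    (hu : ∀ s, HasDerivAt u (h t s) s) (hh : Continuous (h t)) : primitive c h t = u := by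
  funext s
  rw [primitive, integral_eq_sub_of_hasDerivAt (fun s _ => hu s) (hh.intervalIntegrable _ _), hc]
  ring

/-- The family of horizontal curves with the given `x`, `x' = f`, `y' = g` and initial values. -/
noncomputable def horizontalLift (x f g : ℝ → ℝ → ℝ) (c₁ c₂ c₃ : ℝ → ℝ) (t s : ℝ) :
    ℝ × ℝ × ℝ × ℝ :=
  (x t s, primitive c₁ g t s,
    primitive c₂ (fun t s => primitive c₁ g t s * f t s) t s,
    primitive c₃ (fun t s => primitive c₂ (fun t s => primitive c₁ g t s * f t s) t s * f t s) t s)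

variable {x f g : ℝ → ℝ → ℝ} {c₁ c₂ c₃ : ℝ → ℝ}

theorem contDiff_horizontalLift (h : IsBaseFamily x f) (hg : IsAdmissible x g)
    (hc₁ : ContDiff ℝ ∞ c₁) (hc₂ : ContDiff ℝ ∞ c₂) (hc₃ : ContDiff ℝ ∞ c₃) :
    ContDiff ℝ ∞ (Function.uncurry (horizontalLift x f g c₁ c₂ c₃)) := by
  have h1 := contDiff_uncurry_primitive hc₁ hg.contDiff
  have h2 := contDiff_uncurry_primitive hc₂
    (h := fun t s => primitive c₁ g t s * f t s) (h1.mul h.contDiff_f)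
  exact h.contDiff_x.prodMk (h1.prodMk (h2.prodMk
    (contDiff_uncurry_primitive hc₃ (h := fun t s =>
      primitive c₂ (fun t s => primitive c₁ g t s * f t s) t s * f t s) (h2.mul h.contDiff_f))))

theorem isHorizontalLoop_horizontalLift (h : IsBaseFamily x f) (hg : IsAdmissible x g)
    (hc₁ : ContDiff ℝ ∞ c₁) (hc₂ : ContDiff ℝ ∞ c₂) (hc₃ : ContDiff ℝ ∞ c₃)
    {t : ℝ} (himm : ∀ s, f t s = 0 → g t s ≠ 0)
    (hemb : ∀ a b, SelfMeets x g t a b → ∃ k : ℤ, b - a = k) :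
    IsHorizontalLoop (horizontalLift x f g c₁ c₂ c₃ t) ∧
      ∀ s, velocity (horizontalLift x f g c₁ c₂ c₃ t) s = ⟨f t s, g t s⟩ := by
  have s1 := contDiff_uncurry_primitive hc₁ hg.contDiff
  have s2 := contDiff_uncurry_primitive hc₂
    (h := fun t s => primitive c₁ g t s * f t s) (s1.mul h.contDiff_f)
  have d1 := fun s => hasDerivAt_primitive c₁ hg.contDiff t s
  have d2 := fun s => hasDerivAt_primitive c₂
    (h := fun t s => primitive c₁ g t s * f t s) (s1.mul h.contDiff_f) t s
  have d3 := fun s => hasDerivAt_primitive c₃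
    (h := fun t s => primitive c₂ (fun t s => primitive c₁ g t s * f t s) t s * f t s)
    (s2.mul h.contDiff_f) t s
  have hiff : ∀ a b, horizontalLift x f g c₁ c₂ c₃ t a = horizontalLift x f g c₁ c₂ c₃ t b ↔
      SelfMeets x g t a b :=
    horizontal_eq_iff (h.hasDerivAt t) d1 d2 d3 (hg.contDiff.of_uncurry_apply t).continuous
  have e0 : ∀ s, deriv (fun r => (horizontalLift x f g c₁ c₂ c₃ t r).1) s = f t s := fun s =>
    (h.hasDerivAt t s).deriv
  have e1 : ∀ s, deriv (fun r => (horizontalLift x f g c₁ c₂ c₃ t r).2.1) s = g t s := fun s =>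
    (d1 s).deriv
  refine ⟨⟨?_, ?_, ?_, ?_, ?_, ?_⟩, fun s => by rw [velocity, e0, e1]⟩
  · exact (contDiff_horizontalLift h hg hc₁ hc₂ hc₃).comp (f := fun s : ℝ => (t, s))
      (by fun_prop)
  · intro s
    have := selfMeets_add_int h hg t s 1
    rw [Int.cast_one] at this
    exact ((hiff _ _).2 this).symm
  · intro s h0
    have hd : HasDerivAt (horizontalLift x f g c₁ c₂ c₃ t) _ s :=
      (h.hasDerivAt t s).prodMk ((d1 s).prodMk ((d2 s).prodMk (d3 s)))
    rw [hd.deriv] at h0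
    simp only [Prod.mk_eq_zero] at h0
    exact himm s h0.1 h0.2.1
  · intro s
    rw [e0]; exact (d2 s).deriv
  · intro s
    rw [e0]; exact (d3 s).deriv
  · exact fun a b hab => hemb a b ((hiff a b).1 hab)

end Lift

section Realization

theorem mk_div_mk_mem_slitPlane {a b c : ℝ} (h : a = 0 → 0 < b * c) :
    (⟨a, b⟩ / ⟨a, c⟩ : ℂ) ∈ Complex.slitPlane := by
  have hpos : 0 < Complex.normSq ⟨a, c⟩ := by
    refine Complex.normSq_pos.2 fun h0 => ?_
    have ha : a = 0 := congrArg Complex.re h0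
    have hc : c = 0 := congrArg Complex.im h0
    simpa [hc] using h ha
  rw [Complex.mem_slitPlane_iff, Complex.div_re, Complex.div_im, ← add_div, ← sub_div]
  by_cases ha : a = 0
  · exact Or.inl (div_pos (by simpa [ha] using h ha) hpos)
  · by_cases hbc : b = c
    · exact Or.inl (div_pos (by subst hbc; positivity) hpos)
    · refine Or.inr (div_ne_zero ?_ hpos.ne')
      have : b * a - a * c = a * (b - c) := by ring
      simp only [this]
      exact mul_ne_zero ha (sub_ne_zero.2 hbc)

/-- A closed plane curve with velocity direction `(f, v)` is realized, up to a deformation of `v`,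
by an embedded horizontal loop. -/
theorem exists_isHorizontalLoop_of_velocity {x f v : ℝ → ℝ} (hxs : ContDiff ℝ ∞ x)
    (hfs : ContDiff ℝ ∞ f) (hvs : ContDiff ℝ ∞ v) (hx : ∀ s, HasDerivAt x (f s) s)
    (hxp : Function.Periodic x 1) (hvp : Function.Periodic v 1) (hf0 : ∃ s, f s ≠ 0)
    (himm : ∀ s, f s = 0 → v s ≠ 0) (hnull : volume {s | f s = 0} = 0) {n : ℤ}
    (hn : HasWindingNumber (fun s => ⟨f s, v s⟩) n) :
    ∃ γ : ℝ → ℝ × ℝ × ℝ × ℝ, IsHorizontalLoop γ ∧ HasRotationNumber γ n := by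
  have h : IsBaseFamily (fun _ => x) (fun _ => f) :=
    ⟨hxs.comp (f := fun q : ℝ × ℝ => q.2) contDiff_snd,
      hfs.comp (f := fun q : ℝ × ℝ => q.2) contDiff_snd, fun _ => hx, fun _ => hxp, fun _ => hf0⟩
  have hg := h.isAdmissible_corrected_const hvs hvp
  obtain ⟨g', hg', -, hsign, hemb⟩ := h.exists_embedded (ρ := fun _ => 1) hg
    (fun t s hs => by rw [corrected_of_f_eq_zero hs]; exact himm s hs) contDiff_const
    (fun t _ h0 => absurd h0 one_ne_zero) (by
      simp only [ne_eq, one_ne_zero, not_false_eq_true, true_and]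
      exact Measure.quasiMeasurePreserving_snd.preimage_null hnull)
  have h01 : (0 : ℝ) ∈ Icc (0 : ℝ) 1 := by simp
  have hsign' : ∀ s, f s = 0 → 0 < g' 0 s * v s := fun s hs => by
    have := hsign 0 h01 s hs
    rwa [corrected_of_f_eq_zero hs] at this
  obtain ⟨hloop, hvel⟩ := isHorizontalLoop_horizontalLift h hg' (c₁ := fun _ => 0)
    (c₂ := fun _ => 0) (c₃ := fun _ => 0) contDiff_const contDiff_const contDiff_const (t := 0)
    (fun s hs h0 => by simpa [h0] using hsign' s hs) (hemb 0 h01)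
  refine ⟨_, hloop, (hasRotationNumber_iff _ _).2 ?_⟩
  rw [funext hvel]
  have hfc := hfs.continuous
  have hvc := hvs.continuous
  have hgc := (hg'.contDiff.of_uncurry_apply 0).continuous
  have hmk : ∀ {a b : ℝ → ℝ}, Continuous a → Continuous b →
      Continuous fun s => (⟨a s, b s⟩ : ℂ) := by
    intro a b ha hb
    simp only [Complex.mk_eq_add_mul_I]
    fun_prop
  refine hn.of_div_mem_slitPlane (hmk hfc hvc) (hmk hfc hgc) (fun s => ?_) (fun s => ?_)
    fun s => mk_div_mk_mem_slitPlane (hsign' s)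
  · simp only [h.periodic_f 0 s, hvp s]
  · simp only [h.periodic_f 0 s, hg'.periodic 0 s]

open Real in
/-- Every integer is the rotation number of a horizontal loop. -/
theorem exists_isHorizontalLoop_hasRotationNumber (n : ℤ) :
    ∃ γ : ℝ → ℝ × ℝ × ℝ × ℝ, IsHorizontalLoop γ ∧ HasRotationNumber γ n := by
  have hpi := pi_pos
  have key : ∀ m : ℤ, m ≠ 0 → ∀ v : ℝ → ℝ, ContDiff ℝ ∞ v → Function.Periodic v 1 →
      (∀ s, sin (2 * π * m * s) = 0 → v s ≠ 0) →
      HasWindingNumber (fun s => ⟨-sin (2 * π * m * s), v s⟩) n →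
      ∃ γ : ℝ → ℝ × ℝ × ℝ × ℝ, IsHorizontalLoop γ ∧ HasRotationNumber γ n := by
    intro m hm v hv hvp himm hn
    have hm' : (m : ℝ) ≠ 0 := Int.cast_ne_zero.2 hm
    have hc : 2 * π * m ≠ 0 := by positivity
    have hin : ∀ s, HasDerivAt (fun s : ℝ => 2 * π * m * s) (2 * π * m) s := fun s => by
      simpa using (hasDerivAt_id s).const_mul (2 * π * m)
    have hf : ∀ s, HasDerivAt (fun s : ℝ => -sin (2 * π * m * s))
        (-(cos (2 * π * m * s) * (2 * π * m))) s := fun s => ((hin s).sin).neg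
    refine exists_isHorizontalLoop_of_velocity (x := fun s => cos (2 * π * m * s) / (2 * π * m))
      (by fun_prop) (by fun_prop) hv (fun s => ?_) (fun s => ?_) hvp
      ⟨1 / (4 * m), ?_⟩ (fun s hs => himm s (neg_eq_zero.1 hs)) ?_ hn
    · refine (((hin s).cos).div_const (2 * π * m)).congr_deriv ?_
      rw [mul_div_assoc, div_self hc, mul_one]
    · simp only
      rw [show 2 * π * m * (s + 1) = 2 * π * m * s + m * (2 * π) by ring, cos_add_int_mul_two_pi]
    · rw [show 2 * π * m * (1 / (4 * m)) = π / 2 by field_simp; norm_num]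
      simp
    · refine measure_mono_null (fun s hs => ?_) (volume_level_inter_regular_eq_zero hf 0)
      refine ⟨hs, fun h0 => ?_⟩
      have h1 : cos (2 * π * m * s) = 0 := by simpa [hc, hm', hpi.ne'] using h0
      have h2 : sin (2 * π * m * s) = 0 := neg_eq_zero.1 hs
      have := sin_sq_add_cos_sq (2 * π * m * s)
      simp [h1, h2] at this
  by_cases hn : n = 0
  · subst hn
    refine key 1 one_ne_zero (fun _ => 1) contDiff_const (fun _ => rfl) (by simp) ?_
    have hI : HasWindingNumber (fun _ => Complex.I) 0 :=
      ⟨fun _ => π / 2, continuous_const, fun s => by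
        have := Complex.exp_pi_div_two_mul_I
        push_cast
        simp [this], by simp⟩
    refine hI.of_div_mem_slitPlane continuous_const ?_ (fun _ => rfl) (fun s => ?_) fun s => ?_
    · simp only [Complex.mk_eq_add_mul_I]
      fun_prop
    · simp only [Int.cast_one, mul_one]
      rw [show 2 * π * (s + 1) = 2 * π * s + 2 * π by ring, sin_add_two_pi]
    · rw [Complex.mem_slitPlane_iff]
      left
      simp
  · refine key n hn (fun s => cos (2 * π * n * s)) (by fun_prop) (fun s => ?_) (fun s hs h0 => ?_) ?_
    · simp only
      rw [show 2 * π * n * (s + 1) = 2 * π * n * s + n * (2 * π) by ring, cos_add_int_mul_two_pi]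
    · have := sin_sq_add_cos_sq (2 * π * n * s)
      simp [hs, h0] at this
    · refine ⟨fun s => 2 * π * n * s + π / 2, by fun_prop, fun s => ?_, by ring⟩
      rw [eq_norm_mul_exp_iff]
      rw [cos_add_pi_div_two, sin_add_pi_div_two, neg_sq, sin_sq_add_cos_sq]
      simp

end Realization

section IsotopyFromVelocities

theorem exists_mem_Icc_of_periodic {h : ℝ → ℝ} (hp : Function.Periodic h 1) {s : ℝ}
    (hs : h s ≠ 0) : ∃ r ∈ Icc (0 : ℝ) 1, h r ≠ 0 := by
  obtain ⟨r, hr, he⟩ := hp.exists_mem_Ico₀ one_pos s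
  exact ⟨r, ⟨hr.1, hr.2.le⟩, he ▸ hs⟩

theorem isBaseFamily_primitive {c : ℝ → ℝ} {f : ℝ → ℝ → ℝ} (hc : ContDiff ℝ ∞ c)
    (hf : ContDiff ℝ ∞ (Function.uncurry f)) (hp : ∀ t, Function.Periodic (f t) 1)
    (hint : ∀ t, ∫ s in (0 : ℝ)..1, f t s = 0) (hne : ∀ t, ∃ s, f t s ≠ 0) :
    IsBaseFamily (primitive c f) f where
  contDiff_x := contDiff_uncurry_primitive hc hf
  contDiff_f := hf
  hasDerivAt := hasDerivAt_primitive c hf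
  periodic t s := by
    have hfc := (hf.of_uncurry_apply t).continuous
    have h1 := (hp t).intervalIntegral_add_eq s 0
    have h2 := integral_add_adjacent_intervals (hfc.intervalIntegrable (μ := volume) 0 s)
      (hfc.intervalIntegrable s (s + 1))
    rw [h1, zero_add, hint t, add_zero] at h2
    rw [primitive, primitive, h2]
  exists_ne_zero := hne

/-- For almost every `q` the zero set of `F + q E` is a null set, provided that `F` and `E` have
almost no common zeros. -/
theorem exists_volume_zero_set_eq_zero {F E : ℝ × ℝ → ℝ} (hF : Continuous F) (hE : Continuous E)
    {S : Set (ℝ × ℝ)} (hS : MeasurableSet S) (h : ∀ᵐ z, z ∈ S → F z = 0 → E z ≠ 0) :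
    ∃ q : ℝ, volume {z | z ∈ S ∧ F z + q * E z = 0} = 0 := by
  have hm : MeasurableSet {w : (ℝ × ℝ) × ℝ | ¬ (w.1 ∈ S ∧ F w.1 + w.2 * E w.1 = 0)} := by
    refine MeasurableSet.compl ((measurable_fst hS).inter (IsClosed.measurableSet ?_))
    exact isClosed_eq (by fun_prop) continuous_const
  have h1 : ∀ᵐ z : ℝ × ℝ, ∀ᵐ q : ℝ, ¬ (z ∈ S ∧ F z + q * E z = 0) := by
    filter_upwards [h] with z hz
    by_cases hEz : E z = 0
    · exact Eventually.of_forall fun q hq => hz hq.1 (by simpa [hEz] using hq.2) hEz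
    · have : ∀ᵐ q : ℝ, q ≠ -F z / E z := by simp [ae_iff]
      filter_upwards [this] with q hq hq'
      refine hq ?_
      rw [eq_div_iff hEz]
      linarith [hq'.2]
  obtain ⟨q, hq⟩ := ((Measure.ae_ae_comm hm).1 h1).exists
  refine ⟨q, ?_⟩
  rw [ae_iff] at hq
  simpa using hq

theorem volume_cos_eq_eq_zero (m : ℝ) : volume {s : ℝ | Real.cos (2 * Real.pi * s) = m} = 0 := by
  have hpi := Real.pi_pos
  have hin : ∀ s, HasDerivAt (fun s : ℝ => 2 * Real.pi * s) (2 * Real.pi) s := fun s => by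
    simpa using (hasDerivAt_id s).const_mul (2 * Real.pi)
  have h1 := volume_level_inter_regular_eq_zero (fun s => (hin s).cos) m
  have h2 := volume_level_inter_regular_eq_zero (fun s => (hin s).sin) 0
  refine measure_mono_null (fun s hs => ?_) (measure_union_null h1 h2)
  by_cases h0 : Real.sin (2 * Real.pi * s) = 0
  · refine Or.inr ⟨h0, mul_ne_zero (fun h3 => ?_) (by positivity)⟩
    have := Real.sin_sq_add_cos_sq (2 * Real.pi * s)
    simp [h0, h3] at this
  · exact Or.inl ⟨hs, mul_ne_zero (neg_ne_zero.2 h0) (by positivity)⟩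

/-- A family of velocities can be changed by multiples of `v²` so that the first component
integrates to a closed curve and almost never vanishes. -/
theorem exists_closed_velocities {u v : ℝ → ℝ → ℝ} {ρ : ℝ → ℝ} (hρ : ContDiff ℝ ∞ ρ)
    (hu : ContDiff ℝ ∞ (Function.uncurry u)) (hv : ContDiff ℝ ∞ (Function.uncurry v))
    (hup : ∀ t, Function.Periodic (u t) 1) (hvp : ∀ t, Function.Periodic (v t) 1)
    (hne : ∀ t s, v t s = 0 → u t s ≠ 0) (hv1 : ∀ t, ∃ s, v t s ≠ 0) :
    ∃ f : ℝ → ℝ → ℝ, ContDiff ℝ ∞ (Function.uncurry f) ∧ (∀ t, Function.Periodic (f t) 1) ∧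
      (∀ t, ∫ s in (0 : ℝ)..1, f t s = 0) ∧ (∀ t s, v t s = 0 → f t s = u t s) ∧
      (∀ t, ρ t = 0 → ∫ s in (0 : ℝ)..1, u t s = 0 → f t = u t) ∧
      volume {q : ℝ × ℝ | ρ q.1 ≠ 0 ∧ f q.1 q.2 = 0} = 0 := by
  set φ : ℝ → ℝ := fun s => Real.cos (2 * Real.pi * s) with hφ
  have hφs : ContDiff ℝ ∞ φ := by fun_prop
  have hφp : Function.Periodic φ 1 := fun s => by
    simp only [hφ]
    rw [show 2 * Real.pi * (s + 1) = 2 * Real.pi * s + 2 * Real.pi by ring, Real.cos_add_two_pi]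
  set I : ℝ → ℝ := fun t => ∫ s in (0 : ℝ)..1, u t s with hI
  set V : ℝ → ℝ := fun t => ∫ s in (0 : ℝ)..1, v t s ^ 2 with hV
  set J : ℝ → ℝ := fun t => ∫ s in (0 : ℝ)..1, v t s ^ 2 * φ s with hJ
  have hIs : ContDiff ℝ ∞ I := contDiff_intervalIntegral hu
  have hVs : ContDiff ℝ ∞ V := contDiff_intervalIntegral (h := fun t s => v t s ^ 2) (hv.pow 2)
  have hJs : ContDiff ℝ ∞ J := contDiff_intervalIntegral (h := fun t s => v t s ^ 2 * φ s)
    ((hv.pow 2).mul (hφs.comp contDiff_snd))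
  have huc : ∀ t, Continuous (u t) := fun t => (hu.of_uncurry_apply t).continuous
  have hvc : ∀ t, Continuous (v t) := fun t => (hv.of_uncurry_apply t).continuous
  have hφc := hφs.continuous
  have hVpos : ∀ t, 0 < V t := by
    intro t
    obtain ⟨s, hs⟩ := hv1 t
    obtain ⟨r, hr, hvr⟩ := exists_mem_Icc_of_periodic (hvp t) hs
    have := hvc t
    exact integral_pos zero_lt_one (by fun_prop) (fun s _ => sq_nonneg _) ⟨r, hr, by positivity⟩
  set F : ℝ → ℝ → ℝ := fun t s => u t s - v t s ^ 2 * (I t / V t) with hF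
  set E : ℝ → ℝ → ℝ := fun t s => v t s ^ 2 * (ρ t * (φ s - J t / V t)) with hE
  have hFs : ContDiff ℝ ∞ (Function.uncurry F) := hu.sub ((hv.pow 2).mul
    ((hIs.div hVs fun t => (hVpos t).ne').comp contDiff_fst))
  have hEs : ContDiff ℝ ∞ (Function.uncurry E) := (hv.pow 2).mul ((hρ.comp contDiff_fst).mul
    ((hφs.comp contDiff_snd).sub ((hJs.div hVs fun t => (hVpos t).ne').comp contDiff_fst)))
  have hS : MeasurableSet {z : ℝ × ℝ | ρ z.1 ≠ 0} :=
    (isOpen_ne_fun (hρ.continuous.comp continuous_fst) continuous_const).measurableSet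
  have hae : ∀ᵐ z : ℝ × ℝ, φ z.2 ≠ J z.1 / V z.1 := by
    rw [ae_iff]
    simp only [not_not]
    have hcl : IsClosed {z : ℝ × ℝ | φ z.2 = J z.1 / V z.1} :=
      isClosed_eq (hφc.comp continuous_snd)
        ((hJs.div hVs fun t => (hVpos t).ne').continuous.comp continuous_fst)
    rw [Measure.volume_eq_prod, Measure.measure_prod_null hcl.measurableSet]
    exact Eventually.of_forall fun t => volume_cos_eq_eq_zero (J t / V t)
  obtain ⟨q, hq⟩ := exists_volume_zero_set_eq_zero hFs.continuous hEs.continuous hS (by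
    filter_upwards [hae] with z hz hρz hFz
    have hvz : v z.1 z.2 ≠ 0 := fun h0 => hne _ _ h0 (by
      simpa [Function.uncurry, hF, h0] using hFz)
    exact mul_ne_zero (pow_ne_zero 2 hvz) (mul_ne_zero hρz (sub_ne_zero.2 hz)))
  refine ⟨fun t s => F t s + q * E t s, hFs.add (contDiff_const.mul hEs), fun t s => ?_,
    fun t => ?_, fun t s h0 => ?_, fun t hρt hut => ?_, hq⟩
  · simp only [hF, hE, hup t s, hvp t s, hφp s]
  · have h1 := huc t
    have h2 := hvc t
    have hVt := (hVpos t).ne'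
    have e : ∀ s, F t s + q * E t s = u t s - (I t / V t + q * ρ t * (J t / V t)) * v t s ^ 2 +
        q * ρ t * (v t s ^ 2 * φ s) := fun s => by simp only [hF, hE]; ring
    simp only [e]
    rw [intervalIntegral.integral_add (Continuous.intervalIntegrable (by fun_prop) _ _)
        (Continuous.intervalIntegrable (by fun_prop) _ _),
      intervalIntegral.integral_sub (Continuous.intervalIntegrable (by fun_prop) _ _)
        (Continuous.intervalIntegrable (by fun_prop) _ _),
      intervalIntegral.integral_const_mul, intervalIntegral.integral_const_mul]
    change I t - (I t / V t + q * ρ t * (J t / V t)) * V t + q * ρ t * J t = 0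
    field_simp
    ring
  · simp [hF, hE, h0]
  · funext s
    have hIt : I t = 0 := hut
    simp [hF, hE, hρt, hIt]

/-- The coordinates of a horizontal loop and their derivatives. -/
theorem IsHorizontalLoop.hasDerivAt {γ : ℝ → ℝ × ℝ × ℝ × ℝ} (h : IsHorizontalLoop γ) (s : ℝ) :
    HasDerivAt (fun r => (γ r).1) (velocity γ s).re s ∧
      HasDerivAt (fun r => (γ r).2.1) (velocity γ s).im s ∧
      HasDerivAt (fun r => (γ r).2.2.1) ((γ s).2.1 * (velocity γ s).re) s ∧
      HasDerivAt (fun r => (γ r).2.2.2) ((γ s).2.2.1 * (velocity γ s).re) s := by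
  have hd : DifferentiableAt ℝ γ s := h.smooth.differentiable (by simp) s
  refine ⟨hd.fst.hasDerivAt, hd.snd.fst.hasDerivAt, ?_, ?_⟩
  · exact hd.snd.snd.fst.hasDerivAt.congr_deriv (h.tangent_z s)
  · exact hd.snd.snd.snd.hasDerivAt.congr_deriv (h.tangent_w s)

theorem IsHorizontalLoop.contDiff_velocity {γ : ℝ → ℝ × ℝ × ℝ × ℝ} (h : IsHorizontalLoop γ) :
    ContDiff ℝ ∞ (fun s => (velocity γ s).re) ∧ ContDiff ℝ ∞ (fun s => (velocity γ s).im) := by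
  have hx : ContDiff ℝ ∞ fun s => (γ s).1 := h.smooth.fst
  have hy : ContDiff ℝ ∞ fun s => (γ s).2.1 := h.smooth.snd.fst
  exact ⟨(contDiff_infty_iff_deriv.1 hx).2, (contDiff_infty_iff_deriv.1 hy).2⟩

theorem IsHorizontalLoop.eq_iff {γ : ℝ → ℝ × ℝ × ℝ × ℝ} (h : IsHorizontalLoop γ) (a b : ℝ) :
    γ a = γ b ↔ (γ a).1 = (γ b).1 ∧
      ∀ i, moment (fun s => (velocity γ s).im) (fun s => (γ s).1) a b i = 0 :=
  horizontal_eq_iff (fun s => (h.hasDerivAt s).1) (fun s => (h.hasDerivAt s).2.1)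
    (fun s => (h.hasDerivAt s).2.2.1) (fun s => (h.hasDerivAt s).2.2.2)
    h.contDiff_velocity.2.continuous a b

theorem IsHorizontalLoop.integral_velocity_re {γ : ℝ → ℝ × ℝ × ℝ × ℝ} (h : IsHorizontalLoop γ) :
    ∫ s in (0 : ℝ)..1, (velocity γ s).re = 0 := by
  have hp := h.periodic 0
  rw [zero_add] at hp
  rw [integral_eq_sub_of_hasDerivAt (fun s _ => (h.hasDerivAt s).1)
    (h.contDiff_velocity.1.continuous.intervalIntegrable _ _), hp, sub_self]

/-- A horizontal loop is the horizontal lift of its own velocity. -/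
theorem IsHorizontalLoop.horizontalLift_eq {γ : ℝ → ℝ × ℝ × ℝ × ℝ} (h : IsHorizontalLoop γ)
    {x f g : ℝ → ℝ → ℝ} {c₁ c₂ c₃ : ℝ → ℝ} {t : ℝ} (hx : x t = fun s => (γ s).1)
    (hf : f t = fun s => (velocity γ s).re) (hg : g t = fun s => (velocity γ s).im)
    (h₁ : c₁ t = (γ 0).2.1) (h₂ : c₂ t = (γ 0).2.2.1) (h₃ : c₃ t = (γ 0).2.2.2) :
    horizontalLift x f g c₁ c₂ c₃ t = γ := by
  have hfc : Continuous (f t) := hf ▸ h.contDiff_velocity.1.continuous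
  have hgc : Continuous (g t) := hg ▸ h.contDiff_velocity.2.continuous
  have e1 : primitive c₁ g t = fun s => (γ s).2.1 :=
    primitive_eq (u := fun s => (γ s).2.1) h₁ (fun s => by rw [hg]; exact (h.hasDerivAt s).2.1) hgc
  have hγc := h.smooth.continuous
  have e2 : primitive c₂ (fun t s => primitive c₁ g t s * f t s) t = fun s => (γ s).2.2.1 := by
    refine primitive_eq (u := fun s => (γ s).2.2.1) h₂ (fun s => ?_) ?_
    · rw [e1, hf]; exact (h.hasDerivAt s).2.2.1
    · simp only [e1]; fun_prop
  have e3 : primitive c₃ (fun t s => primitive c₂ (fun t s => primitive c₁ g t s * f t s) t s *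
      f t s) t = fun s => (γ s).2.2.2 := by
    refine primitive_eq (u := fun s => (γ s).2.2.2) h₃ (fun s => ?_) ?_
    · rw [e2, hf]; exact (h.hasDerivAt s).2.2.2
    · simp only [e2]; fun_prop
  funext s
  rw [horizontalLift, e1, e2, e3, hx]

end IsotopyFromVelocities

section IsotopyOfVelocities

theorem IsHorizontalLoop.moment_eq_zero {γ : ℝ → ℝ × ℝ × ℝ × ℝ} (h : IsHorizontalLoop γ)
    (i : Fin 3) : moment (fun s => (velocity γ s).im) (fun s => (γ s).1) 0 1 i = 0 := by
  have hp := h.periodic 0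
  rw [zero_add] at hp
  exact ((h.eq_iff 0 1).1 hp.symm).2 i

/-- A smooth cutoff that vanishes on `[0, 1]` exactly at the end points. -/
noncomputable def endpointCutoff (t : ℝ) : ℝ :=
  Real.smoothTransition t * Real.smoothTransition (1 - t)

theorem contDiff_endpointCutoff : ContDiff ℝ ∞ endpointCutoff :=
  Real.smoothTransition.contDiff.mul
    (Real.smoothTransition.contDiff.comp (contDiff_const.sub contDiff_id))

theorem eq_of_endpointCutoff_eq_zero {t : ℝ} (ht : t ∈ Icc (0 : ℝ) 1)
    (h : endpointCutoff t = 0) : t = 0 ∨ t = 1 := by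
  by_contra! hne
  have h0 : 0 < t := lt_of_le_of_ne ht.1 hne.1.symm
  have h1 : 0 < 1 - t := sub_pos.2 (lt_of_le_of_ne ht.2 hne.2)
  exact (mul_pos (Real.smoothTransition.pos_of_pos h0)
    (Real.smoothTransition.pos_of_pos h1)).ne' h

/-- A path of velocities, each with a horizontal and a non-horizontal vector, from the velocity
of `γ₀` to the velocity of `γ₁` gives rise to a horizontal isotopy. -/
theorem exists_isHorizontalIsotopy_of_velocities {γ₀ γ₁ : ℝ → ℝ × ℝ × ℝ × ℝ}
    (h₀ : IsHorizontalLoop γ₀) (h₁ : IsHorizontalLoop γ₁) {u v : ℝ → ℝ → ℝ}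
    (hu : ContDiff ℝ ∞ (Function.uncurry u)) (hv : ContDiff ℝ ∞ (Function.uncurry v))
    (hup : ∀ t, Function.Periodic (u t) 1) (hvp : ∀ t, Function.Periodic (v t) 1)
    (hne : ∀ t s, v t s = 0 → u t s ≠ 0) (hv0 : ∀ t, ∃ s, v t s = 0) (hv1 : ∀ t, ∃ s, v t s ≠ 0)
    (hu₀ : u 0 = fun s => (velocity γ₀ s).re) (hv₀ : v 0 = fun s => (velocity γ₀ s).im)
    (hu₁ : u 1 = fun s => (velocity γ₁ s).re) (hv₁ : v 1 = fun s => (velocity γ₁ s).im) :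
    ∃ H, IsHorizontalIsotopy H ∧ H 0 = γ₀ ∧ H 1 = γ₁ := by
  have hρ0 : endpointCutoff 0 = 0 := by simp [endpointCutoff]
  have hρ1 : endpointCutoff 1 = 0 := by simp [endpointCutoff]
  obtain ⟨f, hf, hfp, hfi, hfu, hfρ, hfZ⟩ :=
    exists_closed_velocities contDiff_endpointCutoff hu hv hup hvp hne hv1
  have hf₀ : f 0 = fun s => (velocity γ₀ s).re :=
    (hfρ 0 hρ0 (by rw [hu₀]; exact h₀.integral_velocity_re)).trans hu₀
  have hf₁ : f 1 = fun s => (velocity γ₁ s).re :=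
    (hfρ 1 hρ1 (by rw [hu₁]; exact h₁.integral_velocity_re)).trans hu₁
  obtain ⟨c, hcs, hc0, hc1⟩ : ∃ c : (ℝ × ℝ × ℝ × ℝ → ℝ) → ℝ → ℝ, (∀ p, ContDiff ℝ ∞ (c p)) ∧
      (∀ p, c p 0 = p (γ₀ 0)) ∧ ∀ p, c p 1 = p (γ₁ 0) :=
    ⟨fun p t => (1 - t) * p (γ₀ 0) + t * p (γ₁ 0), fun p => by fun_prop, by simp, by simp⟩
  set x : ℝ → ℝ → ℝ := primitive (c fun q => q.1) f with hx
  have hb : IsBaseFamily x f := isBaseFamily_primitive (hcs _) hf hfp hfi fun t => by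
    obtain ⟨s, hs⟩ := hv0 t
    exact ⟨s, by rw [hfu t s hs]; exact hne t s hs⟩
  have hx₀ : x 0 = fun s => (γ₀ s).1 :=
    primitive_eq (u := fun s => (γ₀ s).1) (hc0 _)
      (fun s => by rw [hf₀]; exact (h₀.hasDerivAt s).1) (hf.of_uncurry_apply 0).continuous
  have hx₁ : x 1 = fun s => (γ₁ s).1 :=
    primitive_eq (u := fun s => (γ₁ s).1) (hc1 _)
      (fun s => by rw [hf₁]; exact (h₁.hasDerivAt s).1) (hf.of_uncurry_apply 1).continuous
  set g : ℝ → ℝ → ℝ := corrected x f v with hg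
  have hga : IsAdmissible x g := hb.isAdmissible_corrected hv hvp
  have hg₀ : g 0 = fun s => (velocity γ₀ s).im := by
    rw [hg, corrected_of_moment_eq_zero (by rw [hv₀, hx₀]; exact h₀.moment_eq_zero), hv₀]
  have hg₁ : g 1 = fun s => (velocity γ₁ s).im := by
    rw [hg, corrected_of_moment_eq_zero (by rw [hv₁, hx₁]; exact h₁.moment_eq_zero), hv₁]
  have himm : ∀ t s, f t s = 0 → g t s ≠ 0 := by
    intro t s hs h0
    rw [hg, corrected_of_f_eq_zero hs] at h0
    exact hne t s h0 ((hfu t s h0).symm.trans hs)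
  have hemb : ∀ t ∈ Icc (0 : ℝ) 1, endpointCutoff t = 0 → ∀ a b, SelfMeets x g t a b →
      ∃ k : ℤ, b - a = k := by
    intro t ht hρt a b hab
    rcases eq_of_endpointCutoff_eq_zero ht hρt with rfl | rfl
    · rw [SelfMeets, hx₀, hg₀] at hab
      exact h₀.injOnPeriod a b ((h₀.eq_iff a b).2 hab)
    · rw [SelfMeets, hx₁, hg₁] at hab
      exact h₁.injOnPeriod a b ((h₁.eq_iff a b).2 hab)
  obtain ⟨g', hga', hg'ρ, hg'pos, hg'emb⟩ :=
    hb.exists_embedded hga himm contDiff_endpointCutoff hemb hfZ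
  refine ⟨horizontalLift x f g' (c fun q => q.2.1) (c fun q => q.2.2.1) (c fun q => q.2.2.2),
    ⟨(contDiff_horizontalLift hb hga' (hcs _) (hcs _) (hcs _)).contDiffOn, fun t ht => ?_⟩, ?_, ?_⟩
  · exact (isHorizontalLoop_horizontalLift hb hga' (hcs _) (hcs _) (hcs _)
      (fun s hs => left_ne_zero_of_mul (hg'pos t ht s hs).ne') (hg'emb t ht)).1
  · exact h₀.horizontalLift_eq hx₀ hf₀ ((hg'ρ 0 hρ0).trans hg₀) (hc0 _) (hc0 _) (hc0 _)
  · exact h₁.horizontalLift_eq hx₁ hf₁ ((hg'ρ 1 hρ1).trans hg₁) (hc1 _) (hc1 _) (hc1 _)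

end IsotopyOfVelocities

section AnglePath

theorem contDiff_of_contDiff_cos_sin {θ : ℝ → ℝ} (hθ : Continuous θ)
    (hc : ContDiff ℝ ∞ fun s => Real.cos (θ s)) (hs : ContDiff ℝ ∞ fun s => Real.sin (θ s)) :
    ContDiff ℝ ∞ θ := by
  refine contDiff_iff_contDiffAt.2 fun r => ?_
  have hsin : ContDiffAt ℝ ∞ (fun s => Real.sin (θ s - θ r)) r := by
    simp only [Real.sin_sub]
    exact ((hs.mul contDiff_const).sub (hc.mul contDiff_const)).contDiffAt
  have harc : ContDiffAt ℝ ∞ (fun s => θ r + Real.arcsin (Real.sin (θ s - θ r))) r := by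
    refine contDiffAt_const.add (ContDiffAt.comp r (g := Real.arcsin) ?_ hsin)
    exact Real.contDiffAt_arcsin (by simp) (by simp)
  refine harc.congr_of_eventuallyEq ?_
  have hcl : ContinuousAt (fun s => |θ s - θ r|) r := by fun_prop
  have : ∀ᶠ s in 𝓝 r, |θ s - θ r| < Real.pi / 2 :=
    hcl.eventually_lt_const (by simpa using Real.pi_div_two_pos)
  filter_upwards [this] with s hs'
  rw [abs_lt] at hs'
  rw [Real.arcsin_sin (by linarith) (by linarith)]
  ring

/-- Polar coordinates for the velocity of a horizontal loop. -/
theorem IsHorizontalLoop.exists_polar {γ : ℝ → ℝ × ℝ × ℝ × ℝ} (h : IsHorizontalLoop γ) {n : ℤ}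
    (hn : HasWindingNumber (velocity γ) n) :
    ∃ R θ : ℝ → ℝ, ContDiff ℝ ∞ R ∧ ContDiff ℝ ∞ θ ∧ (∀ s, 0 < R s) ∧ Function.Periodic R 1 ∧
      (∀ s, θ (s + 1) = θ s + n * (2 * Real.pi)) ∧
      (∀ s, (velocity γ s).re = R s * Real.cos (θ s)) ∧
      (∀ s, (velocity γ s).im = R s * Real.sin (θ s)) ∧
      (∃ a, Real.sin (θ a) = 0) ∧ ∃ b, Real.sin (θ b) ≠ 0 := by
  obtain ⟨θ, hθ, hpol, hθn⟩ := hn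
  have hne := h.velocity_ne_zero
  have hR : ∀ s, 0 < ‖velocity γ s‖ := fun s => norm_pos_iff.2 (hne s)
  have hre : ∀ s, (velocity γ s).re = ‖velocity γ s‖ * Real.cos (θ s) := fun s => by
    have := congrArg Complex.re (hpol s)
    rwa [Complex.re_ofReal_mul, Complex.exp_ofReal_mul_I_re] at this
  have him : ∀ s, (velocity γ s).im = ‖velocity γ s‖ * Real.sin (θ s) := fun s => by
    have := congrArg Complex.im (hpol s)
    rwa [Complex.im_ofReal_mul, Complex.exp_ofReal_mul_I_im] at this
  obtain ⟨hvr, hvi⟩ := h.contDiff_velocity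
  have hRs : ContDiff ℝ ∞ fun s => ‖velocity γ s‖ := by
    simp only [Complex.norm_eq_sqrt_sq_add_sq]
    refine ((hvr.pow 2).add (hvi.pow 2)).sqrt fun s h0 => (hR s).ne' ?_
    rw [Complex.norm_eq_sqrt_sq_add_sq, h0, Real.sqrt_zero]
  have hcos : ContDiff ℝ ∞ fun s => Real.cos (θ s) := by
    have e : (fun s => Real.cos (θ s)) = fun s => (velocity γ s).re / ‖velocity γ s‖ := by
      funext s
      rw [hre s, mul_div_cancel_left₀ _ (hR s).ne']
    rw [e]
    exact hvr.div hRs fun s => (hR s).ne'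
  have hsin : ContDiff ℝ ∞ fun s => Real.sin (θ s) := by
    have e : (fun s => Real.sin (θ s)) = fun s => (velocity γ s).im / ‖velocity γ s‖ := by
      funext s
      rw [him s, mul_div_cancel_left₀ _ (hR s).ne']
    rw [e]
    exact hvi.div hRs fun s => (hR s).ne'
  have hp0 := h.periodic 0
  rw [zero_add] at hp0
  have hγc := h.smooth.continuous
  refine ⟨fun s => ‖velocity γ s‖, θ, hRs, contDiff_of_contDiff_cos_sin hθ hcos hsin, hR,
    fun s => by simp only [h.velocity_periodic s], fun s => ?_, hre, him, ?_, ?_⟩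
  · have key := eq_of_forall_exp_mul_I_eq_one (δ := fun s => θ (s + 1) - θ s) (by fun_prop)
      (fun s => by
        rw [Complex.ofReal_sub, sub_mul, Complex.exp_sub,
          div_eq_one_iff_eq (Complex.exp_ne_zero _)]
        have h1 := hpol (s + 1)
        rw [h.velocity_periodic s] at h1
        exact mul_left_cancel₀ (by simpa using hne s) (h1.symm.trans (hpol s))) s 0
    simp only [zero_add] at key
    linarith
  · obtain ⟨a, -, ha⟩ := exists_deriv_eq_zero (f := fun s => (γ s).2.1) zero_lt_one
      (by fun_prop) (by rw [hp0])
    have h0 : (velocity γ a).im = 0 := ha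
    rw [him a] at h0
    exact ⟨a, (mul_eq_zero.1 h0).resolve_left (hR a).ne'⟩
  · obtain ⟨b, -, hb⟩ := exists_deriv_eq_zero (f := fun s => (γ s).1) zero_lt_one
      (by fun_prop) (by rw [hp0])
    refine ⟨b, fun h0 => hne b (Complex.ext hb ?_)⟩
    rw [him b, h0, mul_zero, Complex.zero_im]

/-- A smooth periodic function that vanishes at finitely many given points and takes the value
`1`. -/
theorem exists_periodic_eq_zero_on_finset (P : Finset ℝ) : ∃ (φ : ℝ → ℝ) (c : ℝ),
    ContDiff ℝ ∞ φ ∧ Function.Periodic φ 1 ∧ (∀ p ∈ P, φ p = 0) ∧ φ c = 1 := by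
  set ψ : ℝ → ℝ := fun s => ∏ p ∈ P, Real.sin (Real.pi * (s - p)) ^ 2 with hψ
  have hψs : ContDiff ℝ ∞ ψ := contDiff_prod fun p _ => by fun_prop
  have hcount : (⋃ p ∈ P, range fun k : ℤ => p + k).Countable :=
    P.countable_toSet.biUnion fun p _ => countable_range _
  obtain ⟨c, hc⟩ := (hcount.dense_compl ℝ).nonempty
  have hψc : ψ c ≠ 0 := by
    refine Finset.prod_ne_zero_iff.2 fun p hp => pow_ne_zero 2 fun h0 => hc ?_
    obtain ⟨k, hk⟩ := Real.sin_eq_zero_iff.1 h0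
    refine mem_biUnion hp ⟨k, ?_⟩
    have : (k : ℝ) = c - p := mul_right_cancel₀ Real.pi_ne_zero (by rw [hk]; ring)
    simp [this]
  refine ⟨fun s => ψ s / ψ c, c, hψs.div_const _, fun s => ?_, fun p hp => ?_, div_self hψc⟩
  · change ψ (s + 1) / ψ c = ψ s / ψ c
    congr 1
    refine Finset.prod_congr rfl fun p _ => ?_
    rw [show Real.pi * (s + 1 - p) = Real.pi * (s - p) + Real.pi by ring, Real.sin_add_pi, neg_sq]
  · simp only [hψ]
    rw [Finset.prod_eq_zero hp (by simp), zero_div]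

theorem exists_sin_eq_zero_and_ne_zero {Θ : ℝ → ℝ} (hΘ : Continuous Θ) {a c : ℝ}
    (h : Θ a + 2 * Real.pi ≤ Θ c) : (∃ s, Real.sin (Θ s) = 0) ∧ ∃ s, Real.sin (Θ s) ≠ 0 := by
  have hpi := Real.pi_pos
  set k : ℤ := ⌈Θ a / Real.pi⌉ with hk
  have h1 : Θ a ≤ k * Real.pi := (div_le_iff₀ hpi).1 (Int.le_ceil _)
  have h2 : k * Real.pi < Θ a + Real.pi := by
    have := mul_lt_mul_of_pos_right (Int.ceil_lt_add_one (Θ a / Real.pi)) hpi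
    rwa [add_mul, div_mul_cancel₀ _ hpi.ne', one_mul] at this
  constructor
  · obtain ⟨s, hs⟩ := mem_range_of_exists_le_of_exists_ge hΘ ⟨a, h1⟩ ⟨c, by linarith⟩
    exact ⟨s, by rw [hs, Real.sin_int_mul_pi]⟩
  · obtain ⟨s, hs⟩ := mem_range_of_exists_le_of_exists_ge (c := k * Real.pi + Real.pi / 2) hΘ
      ⟨a, by linarith⟩ ⟨c, by linarith⟩
    refine ⟨s, fun h0 => ?_⟩
    rw [hs, Real.sin_add_pi_div_two] at h0
    have := Real.abs_cos_int_mul_pi k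
    simp [h0] at this

/-- Two angle functions are joined by a path of angle functions, each attaining both a multiple of
`π` and a non-multiple of `π`. -/
theorem exists_angle_path {θ₀ θ₁ : ℝ → ℝ} {d : ℝ} (h₀ : ContDiff ℝ ∞ θ₀) (h₁ : ContDiff ℝ ∞ θ₁)
    (hd₀ : ∀ s, θ₀ (s + 1) = θ₀ s + d) (hd₁ : ∀ s, θ₁ (s + 1) = θ₁ s + d)
    (ha₀ : ∃ a, Real.sin (θ₀ a) = 0) (hb₀ : ∃ b, Real.sin (θ₀ b) ≠ 0)
    (ha₁ : ∃ a, Real.sin (θ₁ a) = 0) (hb₁ : ∃ b, Real.sin (θ₁ b) ≠ 0) :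
    ∃ Θ : ℝ → ℝ → ℝ, ContDiff ℝ ∞ (Function.uncurry Θ) ∧ (∀ t s, Θ t (s + 1) = Θ t s + d) ∧
      Θ 0 = θ₀ ∧ Θ 1 = θ₁ ∧
      ∀ t, (∃ s, Real.sin (Θ t s) = 0) ∧ ∃ s, Real.sin (Θ t s) ≠ 0 := by
  obtain ⟨a₀, ha₀⟩ := ha₀
  obtain ⟨b₀, hb₀⟩ := hb₀
  obtain ⟨a₁, ha₁⟩ := ha₁
  obtain ⟨b₁, hb₁⟩ := hb₁
  obtain ⟨φ, c, hφ, hφp, hφ0, hφc⟩ := exists_periodic_eq_zero_on_finset {a₀, b₀, a₁, b₁}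
  set l : ℝ → ℝ := fun t => Real.smoothTransition (3 * t - 1) with hl
  set m : ℝ → ℝ := fun t => Real.smoothTransition (3 * t) * Real.smoothTransition (3 * (1 - t))
    with hm
  have hls : ContDiff ℝ ∞ l := Real.smoothTransition.contDiff.comp (by fun_prop)
  have hms : ContDiff ℝ ∞ m := (Real.smoothTransition.contDiff.comp (by fun_prop)).mul
    (Real.smoothTransition.contDiff.comp (by fun_prop))
  set M : ℝ := 2 * Real.pi + |θ₀ c - θ₀ a₀| + |θ₁ c - θ₁ a₀| with hM
  set Θ : ℝ → ℝ → ℝ := fun t s => (1 - l t) * θ₀ s + l t * θ₁ s + m t * M * φ s with hΘ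
  have hΘs : ContDiff ℝ ∞ (Function.uncurry Θ) := by
    change ContDiff ℝ ∞ fun q : ℝ × ℝ =>
      (1 - l q.1) * θ₀ q.2 + l q.1 * θ₁ q.2 + m q.1 * M * φ q.2
    fun_prop
  have hl0 : ∀ t, t ≤ 1 / 3 → l t = 0 := fun t ht =>
    Real.smoothTransition.zero_of_nonpos (by linarith)
  have hl1 : ∀ t, 2 / 3 ≤ t → l t = 1 := fun t ht =>
    Real.smoothTransition.one_of_one_le (by linarith)
  have hm0 : m 0 = 0 := by simp [hm]
  have hm1 : m 1 = 0 := by simp [hm]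
  refine ⟨Θ, hΘs, fun t s => ?_, ?_, ?_, fun t => ?_⟩
  · simp only [hΘ, hd₀, hd₁, hφp s]; ring
  · funext s; simp [hΘ, hl0 0 (by norm_num), hm0]
  · funext s; simp [hΘ, hl1 1 (by norm_num), hm1]
  · rcases le_or_gt t (1 / 3) with ht | ht
    · exact ⟨⟨a₀, by simpa [hΘ, hl0 t ht, hφ0] using ha₀⟩,
        ⟨b₀, by simpa [hΘ, hl0 t ht, hφ0] using hb₀⟩⟩
    rcases le_or_gt (2 / 3) t with ht' | ht'
    · exact ⟨⟨a₁, by simpa [hΘ, hl1 t ht', hφ0] using ha₁⟩,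
        ⟨b₁, by simpa [hΘ, hl1 t ht', hφ0] using hb₁⟩⟩
    have hmt : m t = 1 := by
      simp only [hm]
      rw [Real.smoothTransition.one_of_one_le (by linarith),
        Real.smoothTransition.one_of_one_le (by linarith), one_mul]
    refine exists_sin_eq_zero_and_ne_zero (hΘs.of_uncurry_apply t).continuous (a := a₀) (c := c) ?_
    have hln : 0 ≤ l t := Real.smoothTransition.nonneg _
    have hlo : l t ≤ 1 := Real.smoothTransition.le_one _
    simp only [hΘ, hmt, hφc, hφ0 a₀ (by simp), hM]
    have e0 := neg_abs_le (θ₀ c - θ₀ a₀)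
    have e1 := neg_abs_le (θ₁ c - θ₁ a₀)
    nlinarith [abs_nonneg (θ₀ c - θ₀ a₀), abs_nonneg (θ₁ c - θ₁ a₀),
      mul_le_mul_of_nonneg_left e0 (sub_nonneg.2 hlo), mul_le_mul_of_nonneg_left e1 hln,
      mul_nonneg hln (abs_nonneg (θ₀ c - θ₀ a₀)),
      mul_nonneg (sub_nonneg.2 hlo) (abs_nonneg (θ₁ c - θ₁ a₀))]

/-- Horizontal loops with equal rotation numbers are horizontally isotopic. -/
theorem exists_isHorizontalIsotopy {γ₀ γ₁ : ℝ → ℝ × ℝ × ℝ × ℝ} (h₀ : IsHorizontalLoop γ₀)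
    (h₁ : IsHorizontalLoop γ₁) {n : ℤ} (hn₀ : HasWindingNumber (velocity γ₀) n)
    (hn₁ : HasWindingNumber (velocity γ₁) n) :
    ∃ H, IsHorizontalIsotopy H ∧ H 0 = γ₀ ∧ H 1 = γ₁ := by
  obtain ⟨R₀, θ₀, hR₀, hθ₀, hR₀pos, hR₀p, hd₀, hre₀, him₀, ha₀, hb₀⟩ := h₀.exists_polar hn₀
  obtain ⟨R₁, θ₁, hR₁, hθ₁, hR₁pos, hR₁p, hd₁, hre₁, him₁, ha₁, hb₁⟩ := h₁.exists_polar hn₁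
  obtain ⟨Θ, hΘ, hΘd, hΘ0, hΘ1, hΘsin⟩ := exists_angle_path hθ₀ hθ₁ hd₀ hd₁ ha₀ hb₀ ha₁ hb₁
  set l : ℝ → ℝ := Real.smoothTransition with hl
  have hls : ContDiff ℝ ∞ l := Real.smoothTransition.contDiff
  set R : ℝ → ℝ → ℝ := fun t s => (1 - l t) * R₀ s + l t * R₁ s with hR
  have hRs : ContDiff ℝ ∞ (Function.uncurry R) := by
    change ContDiff ℝ ∞ fun q : ℝ × ℝ => (1 - l q.1) * R₀ q.2 + l q.1 * R₁ q.2
    fun_prop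
  have hRpos : ∀ t s, R t s ≠ 0 := fun t s => by
    have hln : 0 ≤ l t := Real.smoothTransition.nonneg _
    have hlo : 0 ≤ 1 - l t := sub_nonneg.2 (Real.smoothTransition.le_one _)
    refine (convex_Ioi (0 : ℝ) (hR₀pos s) (hR₁pos s) hlo hln (by ring)).ne'
  have hRp : ∀ t, Function.Periodic (R t) 1 := fun t s => by simp only [hR, hR₀p s, hR₁p s]
  have hR0 : ∀ s, R 0 s = R₀ s := fun s => by simp [hR, hl]
  have hR1 : ∀ s, R 1 s = R₁ s := fun s => by simp [hR, hl]
  refine exists_isHorizontalIsotopy_of_velocities h₀ h₁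
    (u := fun t s => R t s * Real.cos (Θ t s)) (v := fun t s => R t s * Real.sin (Θ t s))
    (hRs.mul hΘ.cos) (hRs.mul hΘ.sin) (fun t s => ?_) (fun t s => ?_) (fun t s hs => ?_)
    (fun t => ?_) (fun t => ?_) ?_ ?_ ?_ ?_
  · simp only [hRp t s, hΘd, Real.cos_add_int_mul_two_pi]
  · simp only [hRp t s, hΘd, Real.sin_add_int_mul_two_pi]
  · have h0 := (mul_eq_zero.1 hs).resolve_left (hRpos t s)
    refine mul_ne_zero (hRpos t s) fun h1 => ?_
    have := Real.sin_sq_add_cos_sq (Θ t s)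
    simp [h0, h1] at this
  · obtain ⟨s, hs⟩ := (hΘsin t).1
    exact ⟨s, by rw [hs, mul_zero]⟩
  · obtain ⟨s, hs⟩ := (hΘsin t).2
    exact ⟨s, mul_ne_zero (hRpos t s) hs⟩
  · funext s; rw [hR0, hΘ0, hre₀]
  · funext s; rw [hR0, hΘ0, him₀]
  · funext s; rw [hR1, hΘ1, hre₁]
  · funext s; rw [hR1, hΘ1, him₁]

end AnglePath

/-- The rotation number induces a bijection between horizontal isotopy classes
of horizontal loops and the integers: (i) two horizontal loops are horizontally
isotopic iff their rotation numbers agree, and (ii) every integer is the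
rotation number of some horizontal loop. -/
theorem rot_bijection_horizontal_loops :
    (∀ (γ₀ γ₁ : ℝ → ℝ × ℝ × ℝ × ℝ) (n₀ n₁ : ℤ),
      IsHorizontalLoop γ₀ → IsHorizontalLoop γ₁ →
      HasRotationNumber γ₀ n₀ → HasRotationNumber γ₁ n₁ →
      ((∃ H : ℝ → ℝ → ℝ × ℝ × ℝ × ℝ,
          IsHorizontalIsotopy H ∧ H 0 = γ₀ ∧ H 1 = γ₁) ↔ n₀ = n₁)) ∧
    (∀ n : ℤ, ∃ γ : ℝ → ℝ × ℝ × ℝ × ℝ,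
      IsHorizontalLoop γ ∧ HasRotationNumber γ n) := by
  refine ⟨fun γ₀ γ₁ n₀ n₁ h₀ h₁ hn₀ hn₁ => ?_, exists_isHorizontalLoop_hasRotationNumber⟩
  rw [hasRotationNumber_iff] at hn₀ hn₁
  constructor
  · rintro ⟨H, hH, rfl, rfl⟩
    exact (hH.hasWindingNumber hn₀).unique h₁.velocity_ne_zero hn₁
  · rintro rfl
    exact exists_isHorizontalIsotopy h₀ h₁ hn₀ hn₁
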